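/- Geodesic dimension estimate: let (X,d,m,G) be a gauge metric measure space satisfying MCP(β) for a distortion coefficient β as in the context, and assume the non-triviality condition m({z ∈ X : z ≠ x and G(x,z) < +∞}) > 0 for every x ∈ supp m. Then dim_geo(x) ≤ N for every x ∈ supp m; in particular dim_H(supp m) ≤ dim_geo(supp m) ≤ N, where dim_H denotes Hausdorff dimension. -/

import Mathlib

open MeasureTheory Filter Set Metric ENNReal Topology

noncomputable section

namespace GMMS

variable {X : Type*}

open Classical in
/-- The support of a Borel measure on a metric space: points all of whose balls have
positive measure. -/
def mSupp [PseudoMetricSpace X] [MeasurableSpace X] (m : Measure X) : Set X :=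
  {x : X | ∀ r : ℝ, 0 < r → 0 < m (Metric.ball x r)}

/-- A measure which is finite on every bounded set. -/
def FiniteOnBounded [PseudoMetricSpace X] [MeasurableSpace X] (m : Measure X) : Prop :=
  ∀ s : Set X, Bornology.IsBounded s → m s < ⊤

open Classical in
/-- The nonnegative part of an extended real number, in `[0,∞]`. -/
def epos (x : EReal) : ℝ≥0∞ := if x = ⊤ then ⊤ else ENNReal.ofReal x.toReal

/-- Integral of an `EReal`-valued function, defined as the difference of the lower integrals of
the positive and negative parts (with the `EReal` convention `⊤ - ⊤ = ⊥`). -/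
def eintegral {α : Type*} [MeasurableSpace α] (ν : Measure α) (f : α → EReal) : EReal :=
  ((∫⁻ a, epos (f a) ∂ν : ℝ≥0∞) : EReal) - ((∫⁻ a, epos (-(f a)) ∂ν : ℝ≥0∞) : EReal)

/-- `𝒟 = inf {θ > 0 | s θ = 0} ∈ (0,+∞]`. -/
def Dcal (s : ℝ → ℝ) : ℝ≥0∞ :=
  sInf (ENNReal.ofReal '' {θ : ℝ | 0 < θ ∧ s θ = 0})

/-- The distortion coefficient `β` associated with the data `(s, N)`:
`β t 0 = t ^ N`, `β t θ = s (t θ) / s θ` for `0 < θ < 𝒟`, and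
`β t θ = liminf_{φ → 𝒟⁻} s (t φ) / s φ` for `θ ≥ 𝒟`. -/
def beta (s : ℝ → ℝ) (N : ℝ) (t : ℝ) (θ : ℝ≥0∞) : ℝ≥0∞ :=
  if θ = 0 then ENNReal.ofReal (t ^ N)
  else if θ < Dcal s then ENNReal.ofReal (s (t * θ.toReal) / s θ.toReal)
  else Filter.liminf (fun φ : ℝ≥0∞ => ENNReal.ofReal (s (t * φ.toReal) / s φ.toReal))
      (nhdsWithin (Dcal s) (Set.Iio (Dcal s)))

open Classical in
/-- The data `(s, N)` defining a distortion coefficient: `N ∈ [1,∞)`, `s` continuous on `[0,∞)`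
with `s θ = c θ^N + o(θ^N)` as `θ → 0⁺`, for some `c > 0`. -/
structure DistortionData (s : ℝ → ℝ) (N : ℝ) : Prop where
  one_le : 1 ≤ N
  cont : ContinuousOn s (Set.Ici 0)
  asymp : ∃ c : ℝ, 0 < c ∧
    (fun θ : ℝ => s θ - c * θ ^ N) =o[nhdsWithin 0 (Set.Ioi 0)] (fun θ : ℝ => θ ^ N)

/-- The space of (constant-speed, defined on `[0,1]`) geodesics of a metric space. -/
abbrev GeoSpace (X : Type*) [MetricSpace X] : Type _ :=
  {γ : C(unitInterval, X) //
    ∀ s t : unitInterval, dist (γ s) (γ t) = |(s : ℝ) - (t : ℝ)| * dist (γ 0) (γ 1)}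

instance [MetricSpace X] : MeasurableSpace (GeoSpace X) := borel _

/-- Evaluation of a geodesic at time `t ∈ [0,1]`. -/
def geval [MetricSpace X] (γ : GeoSpace X) (t : ℝ) : X :=
  γ.1 (Set.projIcc 0 1 zero_le_one t)

/-- The squared quadratic Kantorovich-Rubinstein-Wasserstein transportation cost. -/
def W2sq [MetricSpace X] [MeasurableSpace X] (μ ν : Measure X) : ℝ≥0∞ :=
  ⨅ (π : Measure (X × X)) (_ : π.map Prod.fst = μ) (_ : π.map Prod.snd = ν),
    ∫⁻ p, edist p.1 p.2 ^ 2 ∂π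

/-- A `W₂`-geodesic: a curve of probability measures with finite second moment such that
`W₂(μ_s, μ_t) = |s - t| W₂(μ_0, μ_1)`. -/
structure IsW2Geo [MetricSpace X] [MeasurableSpace X] (μ : ℝ → Measure X) : Prop where
  prob : ∀ t ∈ Set.Icc (0:ℝ) 1, IsProbabilityMeasure (μ t)
  moment : ∀ t ∈ Set.Icc (0:ℝ) 1, ∃ x₀ : X, ∫⁻ x, edist x x₀ ^ 2 ∂(μ t) < ⊤
  geo : ∀ s ∈ Set.Icc (0:ℝ) 1, ∀ t ∈ Set.Icc (0:ℝ) 1,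
    W2sq (μ s) (μ t) = ENNReal.ofReal ((s - t) ^ 2) * W2sq (μ 0) (μ 1)

/-- Optimal dynamical plans from `μ0` to `μ1`. -/
def OptGeoSet [MetricSpace X] [MeasurableSpace X] (μ0 μ1 : Measure X) :
    Set (Measure (GeoSpace X)) :=
  {ν | IsProbabilityMeasure ν ∧
    (ν.map fun γ => (geval γ 0, geval γ 1)).map Prod.fst = μ0 ∧
    (ν.map fun γ => (geval γ 0, geval γ 1)).map Prod.snd = μ1 ∧
    ∫⁻ p, edist p.1 p.2 ^ 2 ∂(ν.map fun γ => (geval γ 0, geval γ 1)) = W2sq μ0 μ1}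

open Classical in
/-- The Boltzmann-Shannon relative entropy `Ent(μ|m) = ∫ ρ log ρ dm` if `μ = ρ m` with
`ρ log ρ ∈ L¹(m)`, and `+∞` otherwise. -/
def Ent [MeasurableSpace X] (μ m : Measure X) : EReal :=
  if μ ≪ m ∧
      Integrable (fun x => (μ.rnDeriv m x).toReal * Real.log (μ.rnDeriv m x).toReal) m
  then ((∫ x, (μ.rnDeriv m x).toReal * Real.log (μ.rnDeriv m x).toReal ∂m : ℝ) : EReal)
  else (⊤ : EReal)

/-- The dimensional entropy `U_n(μ|m) = exp (-Ent(μ|m)/n)`, with value `0` when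
`Ent(μ|m) = +∞`. -/
def UnE [MeasurableSpace X] (n : ℝ) (μ m : Measure X) : ℝ≥0∞ :=
  EReal.exp (((n⁻¹ : ℝ) : EReal) * (-(Ent μ m)))

/-- Probability measures with bounded support contained in `supp m`. -/
def Pbs [MetricSpace X] [MeasurableSpace X] (m : Measure X) : Set (Measure X) :=
  {μ | IsProbabilityMeasure μ ∧ Bornology.IsBounded (mSupp μ) ∧ mSupp μ ⊆ mSupp m}

/-- Probability measures with bounded support contained in `supp m` and finite entropy. -/
def PbsStar [MetricSpace X] [MeasurableSpace X] (m : Measure X) : Set (Measure X) :=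
  {μ | μ ∈ Pbs m ∧ Ent μ m ≠ ⊤}

/-- The coefficient `exp ((1/n) ∫ log (f γ) dν(γ))` appearing in the `CD(β,n)` inequality. -/
def cdCoeff [MetricSpace X] (n : ℝ) (ν : Measure (GeoSpace X)) (f : GeoSpace X → ℝ≥0∞) :
    ℝ≥0∞ :=
  EReal.exp (((n⁻¹ : ℝ) : EReal) * eintegral ν fun γ => ENNReal.log (f γ))

/-- The `CD` convexity inequality along the dynamical plan `ν`, for a coefficient
`b : [0,1] × [0,∞] → [0,∞]` (with the conventions `∞ ⬝ 0 = 0` of `ℝ≥0∞`). -/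
def CDineq [MetricSpace X] [MeasurableSpace X] (m : Measure X) (G : X → X → ℝ≥0∞)
    (b : ℝ → ℝ≥0∞ → ℝ≥0∞) (n : ℝ) (μ0 μ1 : Measure X) (ν : Measure (GeoSpace X)) : Prop :=
  ∀ t ∈ Set.Ioo (0:ℝ) 1,
    cdCoeff n ν (fun γ => b (1 - t) (G (geval γ 1) (geval γ 0))) * UnE n μ0 m
      + cdCoeff n ν (fun γ => b t (G (geval γ 0) (geval γ 1))) * UnE n μ1 m
      ≤ UnE n (ν.map fun γ => geval γ t) m

/-- The curvature-dimension condition `CD(b, n)` for the gauge metric measure space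
`(X, d, m, G)`. -/
def CD [MetricSpace X] [MeasurableSpace X] (m : Measure X) (G : X → X → ℝ≥0∞)
    (b : ℝ → ℝ≥0∞ → ℝ≥0∞) (n : ℝ) : Prop :=
  ∀ μ0 ∈ Pbs m, ∀ μ1 ∈ PbsStar m, mSupp μ0 ∩ mSupp μ1 = ∅ →
    ∃ ν ∈ OptGeoSet μ0 μ1, CDineq m G b n μ0 μ1 ν

/-- The strong curvature-dimension condition: the `CD` inequality holds along every
optimal dynamical plan. -/
def CDStrong [MetricSpace X] [MeasurableSpace X] (m : Measure X) (G : X → X → ℝ≥0∞)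
    (b : ℝ → ℝ≥0∞ → ℝ≥0∞) (n : ℝ) : Prop :=
  ∀ μ0 ∈ Pbs m, ∀ μ1 ∈ PbsStar m, mSupp μ0 ∩ mSupp μ1 = ∅ →
    ∀ ν ∈ OptGeoSet μ0 μ1, CDineq m G b n μ0 μ1 ν

/-- The measure contraction property `MCP(b)` for the gauge metric measure space
`(X, d, m, G)`. -/
def MCP [MetricSpace X] [MeasurableSpace X] (m : Measure X) (G : X → X → ℝ≥0∞)
    (b : ℝ → ℝ≥0∞ → ℝ≥0∞) : Prop :=
  ∀ x ∈ mSupp m, ∀ μ1 ∈ PbsStar m, x ∉ mSupp μ1 →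
    ∃ μ : ℝ → Measure X, IsW2Geo μ ∧ μ 0 = Measure.dirac x ∧ μ 1 = μ1 ∧
      ∀ t ∈ Set.Ioo (0:ℝ) 1, ∀ n : ℝ, 1 ≤ n →
        EReal.exp (((n⁻¹ : ℝ) : EReal) * eintegral μ1 fun y => ENNReal.log (b t (G x y)))
            * UnE n μ1 m
          ≤ UnE n (μ t) m

/-- The set of `t`-intermediate points between `A0` and `A1`. -/
def Zt [MetricSpace X] (t : ℝ) (A0 A1 : Set X) : Set X :=
  {x | ∃ γ : GeoSpace X, geval γ 0 ∈ A0 ∧ geval γ 1 ∈ A1 ∧ geval γ t = x}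

/-- The distortion coefficient `β_t(A0, A1)` between two sets. -/
def betaSet [MetricSpace X] [MeasurableSpace X] (m : Measure X) (G : X → X → ℝ≥0∞)
    (b : ℝ≥0∞ → ℝ≥0∞) (A0 A1 : Set X) : ℝ≥0∞ :=
  ⨆ (A0' : Set X) (_ : A0' ⊆ A0) (_ : A0'.Nonempty) (_ : m (A0 \ A0') = 0)
    (A1' : Set X) (_ : A1' ⊆ A1) (_ : A1'.Nonempty) (_ : m (A1 \ A1') = 0),
    ⨅ (x0 : X) (_ : x0 ∈ A0' ∩ mSupp m) (x1 : X) (_ : x1 ∈ A1' ∩ mSupp m), b (G x0 x1)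

/-- The "true" distortion coefficient of a metric measure space. -/
def trueBeta [MetricSpace X] [MeasurableSpace X] (m : Measure X) (t : ℝ) (x y : X) : ℝ≥0∞ :=
  Filter.limsup (fun r : ℝ => m (Zt t {x} (Metric.ball y r)) / m (Metric.ball y r))
    (nhdsWithin 0 (Set.Ioi 0))

/-- The `G`-diameter of a set. -/
def diamG [MetricSpace X] [MeasurableSpace X] (m : Measure X) (G : X → X → ℝ≥0∞)
    (S : Set X) : ℝ≥0∞ :=
  ⨆ x ∈ S, essSup (fun y => G x y) (m.restrict (S \ {x}))

/-- The quantity `C_σ(x)` entering the definition of the geodesic dimension. -/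
def Csig [MetricSpace X] [MeasurableSpace X] (m : Measure X) (σ : ℝ) (x : X) : ℝ≥0∞ :=
  ⨆ (A : Set X) (_ : MeasurableSet A) (_ : Bornology.IsBounded A) (_ : x ∉ A)
    (_ : 0 < m A) (_ : m A < ⊤),
    Filter.limsup (fun t : ℝ => ENNReal.ofReal (t ^ (-σ)) * m (Zt t {x} A) / m A)
      (nhdsWithin 0 (Set.Ioi 0))

/-- The geodesic dimension at a point. -/
def dimGeo [MetricSpace X] [MeasurableSpace X] (m : Measure X) (x : X) : ℝ≥0∞ :=
  sInf (ENNReal.ofReal '' {σ : ℝ | 0 < σ ∧ Csig m σ x = ⊤})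

/-- The geodesic dimension of a set. -/
def dimGeoS [MetricSpace X] [MeasurableSpace X] (m : Measure X) (S : Set X) : ℝ≥0∞ :=
  ⨆ x ∈ S, dimGeo m x

/-- The gauge `G` is meek. -/
def Meek [MetricSpace X] [MeasurableSpace X] (m : Measure X) (G : X → X → ℝ≥0∞) : Prop :=
  ∀ x ∈ mSupp m, ∀ μ1 ∈ PbsStar m, x ∉ mSupp μ1 →
    ∀ ν ∈ OptGeoSet (Measure.dirac x) μ1,
      ∃ Γ : Set (GeoSpace X), MeasurableSet Γ ∧ ν Γ = 1 ∧
        ∀ γ ∈ Γ, ∀ t ∈ Set.Ioc (0:ℝ) 1,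
          G (geval γ 0) (geval γ t) = ENNReal.ofReal t * G (geval γ 0) (geval γ 1)

/-- The measure `v_G(x₀, r, ρ)` of the intersection of a gauge sublevel set with a metric
ball. -/
def vG [MetricSpace X] [MeasurableSpace X] (m : Measure X) (G : X → X → ℝ≥0∞)
    (x0 : X) (r ρ : ℝ) : ℝ≥0∞ :=
  m {x | G x0 x ≤ ENNReal.ofReal r ∧ dist x0 x ≤ ρ}

/-- `(supp m, d)` is a geodesic space: any two points of the support are joined by a geodesic
contained in the support. -/
def GeodesicSupp [MetricSpace X] [MeasurableSpace X] (m : Measure X) : Prop :=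
  ∀ x ∈ mSupp m, ∀ y ∈ mSupp m, ∃ γ : GeoSpace X,
    geval γ 0 = x ∧ geval γ 1 = y ∧ ∀ t ∈ Set.Icc (0:ℝ) 1, geval γ t ∈ mSupp m

theorem exists_glued_couplings [MeasurableSpace X] [StandardBorelSpace X] [Nonempty X]
    (ν : ℕ → Measure X) (π : ℕ → Measure (X × X)) (n : ℕ)
    (hν : ∀ i ≤ n, IsProbabilityMeasure (ν i))
    (h1 : ∀ i < n, (π i).map Prod.fst = ν i) (h2 : ∀ i < n, (π i).map Prod.snd = ν (i + 1)) :
    ∃ P : Measure (ℕ → X), IsProbabilityMeasure P ∧ (∀ i ≤ n, P.map (fun ω => ω i) = ν i) ∧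
      ∀ i < n, P.map (fun ω => (ω i, ω (i + 1))) = π i := by
  induction n with
  | zero =>
    have := hν 0 le_rfl
    have hmeas : Measurable (fun (x : X) (_ : ℕ) => x) := by fun_prop
    refine ⟨(ν 0).map (fun x _ => x), Measure.isProbabilityMeasure_map hmeas.aemeasurable, ?_, ?_⟩
    · intro i hi
      obtain rfl : i = 0 := by omega
      rw [Measure.map_map (by fun_prop) hmeas]
      exact Measure.map_id
    · intro i hi
      omega
  | succ n ih =>
    obtain ⟨P, hP, hPν, hPπ⟩ := ih (fun i hi => hν i (by omega)) (fun i hi => h1 i (by omega))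
      (fun i hi => h2 i (by omega))
    have hνn := hν n (by omega)
    have hfst : (π n).fst = ν n := h1 n (by omega)
    have : IsProbabilityMeasure (π n) := by
      refine ⟨?_⟩
      rw [← Measure.fst_univ, hfst]
      exact measure_univ
    set κ := (π n).condKernel with hκ
    have hdis : (ν n).compProd κ = π n := by
      rw [← hfst]; exact (π n).disintegrate κ
    have hev : Measurable (fun ω : ℕ → X => ω n) := measurable_pi_apply n
    set Q := P.compProd (κ.comap _ hev) with hQ
    have hu : Measurable (fun p : (ℕ → X) × X => Function.update p.1 (n + 1) p.2) := by
      refine measurable_pi_lambda _ fun i => ?_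
      by_cases hi : i = n + 1
      · subst hi; simpa using measurable_snd
      · simp only [Function.update_of_ne hi]; fun_prop
    have hQfst : Q.map Prod.fst = P := Measure.fst_compProd P _
    have hQpair : Q.map (fun p => (p.1 n, p.2)) = π n := by
      rw [← hdis]
      refine Measure.ext_of_lintegral _ fun f hf => ?_
      rw [lintegral_map hf (by fun_prop), hQ, Measure.lintegral_compProd (by fun_prop),
        Measure.lintegral_compProd hf, ← hPν n le_rfl,
        lintegral_map (Measurable.lintegral_kernel_prod_right' hf) (by fun_prop)]
      rfl
    have hlow : ∀ i ≤ n, (Q.map (fun p : (ℕ → X) × X => Function.update p.1 (n + 1) p.2)).map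
        (fun ω => ω i) = ν i := by
      intro i hi
      rw [Measure.map_map (by fun_prop) hu, ← hPν i hi]
      conv_rhs => rw [← hQfst, Measure.map_map (by fun_prop) (by fun_prop)]
      congr 1
      ext p
      simp [Function.update_of_ne (show i ≠ n + 1 by omega)]
    have hpairs : ∀ i < n + 1, (Q.map (fun p : (ℕ → X) × X => Function.update p.1 (n + 1) p.2)).map
        (fun ω => (ω i, ω (i + 1))) = π i := by
      intro i hi
      rw [Measure.map_map (by fun_prop) hu]
      by_cases hin : i = n
      · subst hin
        rw [← hQpair]
        congr 1
        ext p <;> simp [Function.update_of_ne]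
      · rw [← hPπ i (by omega)]
        conv_rhs => rw [← hQfst, Measure.map_map (by fun_prop) (by fun_prop)]
        congr 1
        ext p <;> simp [Function.update_of_ne (show i ≠ n + 1 by omega), hin]
    refine ⟨Q.map (fun p => Function.update p.1 (n + 1) p.2),
      Measure.isProbabilityMeasure_map hu.aemeasurable, ?_, hpairs⟩
    intro i hi
    rcases Nat.lt_or_ge n i with h | h
    · obtain rfl : i = n + 1 := by omega
      rw [← h2 n (by omega), ← hpairs n (by omega),
        Measure.map_map (g := Prod.snd) (by fun_prop) (by fun_prop)]
      rfl
    · exact hlow i h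

theorem sq_add_mul_sum_sub_sq_le (M : ℕ) (hM : M ≠ 0) (f : ℕ → ℝ) (h : ℝ) (h0 : 0 ≤ h)
    (hf : h ≤ ∑ i ∈ Finset.range M, f i) :
    M * ∑ i ∈ Finset.range M, (f i - h / M) ^ 2 + h ^ 2
      ≤ M * ∑ i ∈ Finset.range M, f i ^ 2 := by
  have hM' : (M : ℝ) ≠ 0 := by exact_mod_cast hM
  have key : (M : ℝ) * ∑ i ∈ Finset.range M, (f i - h / M) ^ 2
      = M * ∑ i ∈ Finset.range M, f i ^ 2 - 2 * h * ∑ i ∈ Finset.range M, f i + h ^ 2 := by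
    simp only [sub_sq, Finset.sum_add_distrib, Finset.sum_sub_distrib, Finset.sum_const,
      Finset.card_range, nsmul_eq_mul, ← Finset.sum_mul, ← Finset.mul_sum]
    field_simp
  nlinarith [mul_le_mul_of_nonneg_left hf h0]

theorem W2sq_le_lintegral_of_map [MetricSpace X] [MeasurableSpace X] {Ω : Type*}
    [MeasurableSpace Ω] (P : Measure Ω) (f g : Ω → X) (hf : Measurable f) (hg : Measurable g)
    [OpensMeasurableSpace (X × X)] :
    W2sq (P.map f) (P.map g) ≤ ∫⁻ ω, edist (f ω) (g ω) ^ 2 ∂P := by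
  refine (iInf₂_le (P.map fun ω => (f ω, g ω)) ?_).trans ((iInf_le _ ?_).trans ?_)
  · rw [Measure.map_map (by fun_prop) (by fun_prop)]; rfl
  · rw [Measure.map_map (by fun_prop) (by fun_prop)]; rfl
  · have : Measurable fun p : X × X => edist p.1 p.2 ^ 2 :=
      (continuous_edist.measurable).pow_const 2
    rw [lintegral_map this (by fun_prop)]

theorem exists_coupling_lt_of_W2sq_lt [MetricSpace X] [MeasurableSpace X] {μ ν : Measure X}
    {c : ℝ≥0∞} (h : W2sq μ ν < c) :
    ∃ π : Measure (X × X), π.map Prod.fst = μ ∧ π.map Prod.snd = ν ∧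
      ∫⁻ p, edist p.1 p.2 ^ 2 ∂π < c := by
  simpa only [W2sq, iInf_lt_iff, exists_prop] using h

theorem IsW2Geo.exists_chain [MetricSpace X] [MeasurableSpace X] [BorelSpace X] [CompleteSpace X]
    [SecondCountableTopology X] {μ : ℝ → Measure X} (hμ : IsW2Geo μ)
    (hW : W2sq (μ 0) (μ 1) ≠ ⊤) (M : ℕ) (hM : M ≠ 0) (δ : ℝ) (hδ : 0 < δ) (ε : ℝ≥0∞)
    (hε : ε ≠ 0) :
    ∃ P : Measure (ℕ → X), IsProbabilityMeasure P ∧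
      (∀ i ≤ M, P.map (fun ω => ω i) = μ ((i : ℝ) / M)) ∧
      P {ω | ∃ i < M, dist (ω 0) (ω M) / M + δ < dist (ω i) (ω (i + 1))} ≤ ε := by
  have hMr : (0 : ℝ) < M := by exact_mod_cast Nat.pos_of_ne_zero hM
  have hMe : (M : ℝ≥0∞) ≠ 0 := by exact_mod_cast hM
  have hMt : (M : ℝ≥0∞) ≠ ⊤ := ENNReal.natCast_ne_top M
  have hmem : ∀ i ≤ M, ((i : ℝ) / M) ∈ Set.Icc (0 : ℝ) 1 := by
    intro i hi
    refine ⟨by positivity, ?_⟩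
    rw [div_le_one hMr]
    exact_mod_cast hi
  have hne : Nonempty X := by
    have := hμ.prob 0 (by simp)
    exact nonempty_of_isProbabilityMeasure (μ 0)
  set W := W2sq (μ 0) (μ 1) with hWdef
  set a : ℝ≥0∞ := ENNReal.ofReal (M * δ ^ 2) with ha
  have ha0 : a ≠ 0 := by
    rw [ha]; simp only [ne_eq, ENNReal.ofReal_eq_zero, not_le]; positivity
  have hat : a ≠ ⊤ := ENNReal.ofReal_ne_top
  set η : ℝ≥0∞ := a * ε / (M * M) with hη
  have hη0 : η ≠ 0 := by
    rw [hη]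
    refine (ENNReal.div_pos (mul_ne_zero ha0 hε) (ENNReal.mul_ne_top hMt hMt)).ne'
  set w : ℝ≥0∞ := W / (M * M) with hw
  have hwt : w ≠ ⊤ := ENNReal.div_ne_top hW (mul_ne_zero hMe hMe)
  have hstep : ∀ i < M, W2sq (μ ((i : ℝ) / M)) (μ (((i + 1 : ℕ) : ℝ) / M)) = w := by
    intro i hi
    rw [hw, hμ.geo _ (hmem i hi.le) _ (hmem (i + 1) hi), div_eq_mul_inv W, mul_comm]
    congr 1
    have : ((i : ℝ) / M - ((i + 1 : ℕ) : ℝ) / M) ^ 2 = (M * M : ℝ)⁻¹ := by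
      push_cast; field_simp; ring
    rw [this, ENNReal.ofReal_inv_of_pos (by positivity), ENNReal.ofReal_mul hMr.le]
    simp
  have hπ : ∀ i : ℕ, ∃ π : Measure (X × X), i < M → π.map Prod.fst = μ ((i : ℝ) / M) ∧
      π.map Prod.snd = μ (((i + 1 : ℕ) : ℝ) / M) ∧ ∫⁻ p, edist p.1 p.2 ^ 2 ∂π < w + η := by
    intro i
    by_cases hi : i < M
    · obtain ⟨π, h⟩ := exists_coupling_lt_of_W2sq_lt (c := w + η)
        (by rw [hstep i hi]; exact ENNReal.lt_add_right hwt hη0)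
      exact ⟨π, fun _ => h⟩
    · exact ⟨0, fun h => absurd h hi⟩
  choose π hπ using hπ
  obtain ⟨P, hP, hPμ, hPπ⟩ := exists_glued_couplings (fun i : ℕ => μ ((i : ℝ) / M)) π M
    (fun i hi => hμ.prob _ (hmem i hi)) (fun i hi => (hπ i hi).1) (fun i hi => (hπ i hi).2.1)
  refine ⟨P, hP, hPμ, ?_⟩
  have hsqmeas : Measurable fun p : X × X => edist p.1 p.2 ^ 2 :=
    (continuous_edist.measurable).pow_const 2
  have hdm : ∀ i j : ℕ, Measurable fun ω : ℕ → X => edist (ω i) (ω j) ^ 2 := fun i j =>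
    hsqmeas.comp (g := fun p : X × X => edist p.1 p.2 ^ 2)
      (f := fun ω : ℕ → X => (ω i, ω j)) (by fun_prop)
  have hdr : ∀ i j : ℕ, Measurable fun ω : ℕ → X => dist (ω i) (ω j) := fun i j => by fun_prop
  have hWle : W ≤ ∫⁻ ω, edist (ω 0) (ω M) ^ 2 ∂P := by
    have := W2sq_le_lintegral_of_map P (fun ω => ω 0) (fun ω => ω M) (by fun_prop) (by fun_prop)
    rw [hPμ 0 (by omega), hPμ M le_rfl, Nat.cast_zero, zero_div, div_self hMr.ne'] at this
    exact this
  set g : (ℕ → X) → ℝ := fun ω => M * ∑ i ∈ Finset.range M,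
    (dist (ω i) (ω (i + 1)) - dist (ω 0) (ω M) / M) ^ 2 with hg
  have hgm : Measurable g := by fun_prop
  have hbad : {ω | ∃ i < M, dist (ω 0) (ω M) / M + δ < dist (ω i) (ω (i + 1))}
      ⊆ {ω | a ≤ ENNReal.ofReal (g ω)} := by
    rintro ω ⟨i, hi, h⟩
    refine ENNReal.ofReal_le_ofReal ?_
    refine mul_le_mul_of_nonneg_left ?_ hMr.le
    calc δ ^ 2 ≤ (dist (ω i) (ω (i + 1)) - dist (ω 0) (ω M) / M) ^ 2 :=
          pow_le_pow_left₀ hδ.le (by linarith) 2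
      _ ≤ _ := Finset.single_le_sum
          (f := fun i => (dist (ω i) (ω (i + 1)) - dist (ω 0) (ω M) / M) ^ 2)
          (fun _ _ => sq_nonneg _) (Finset.mem_range.2 hi)
  have hpt : ∀ ω : ℕ → X, ENNReal.ofReal (g ω) + edist (ω 0) (ω M) ^ 2
      ≤ M * ∑ i ∈ Finset.range M, edist (ω i) (ω (i + 1)) ^ 2 := by
    intro ω
    have h := sq_add_mul_sum_sub_sq_le M hM (fun i => dist (ω i) (ω (i + 1)))
      (dist (ω 0) (ω M)) dist_nonneg (dist_le_range_sum_dist ω M)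
    have h2 := ENNReal.ofReal_le_ofReal h
    rw [ENNReal.ofReal_add (by positivity) (by positivity), ENNReal.ofReal_mul hMr.le,
      ENNReal.ofReal_mul hMr.le,
      ENNReal.ofReal_sum_of_nonneg (s := Finset.range M)
        (f := fun i => dist (ω i) (ω (i + 1)) ^ 2) (fun _ _ => by positivity)] at h2
    simp only [edist_dist, hg, ENNReal.ofReal_mul hMr.le]
    simpa [ENNReal.ofReal_pow dist_nonneg] using h2
  have hint : a * P {ω | a ≤ ENNReal.ofReal (g ω)} + W ≤ a * ε + W := by
    calc a * P {ω | a ≤ ENNReal.ofReal (g ω)} + W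
        ≤ ∫⁻ ω, ENNReal.ofReal (g ω) ∂P + ∫⁻ ω, edist (ω 0) (ω M) ^ 2 ∂P :=
          add_le_add (mul_meas_ge_le_lintegral (by fun_prop) a) hWle
      _ = ∫⁻ ω, (ENNReal.ofReal (g ω) + edist (ω 0) (ω M) ^ 2) ∂P :=
          (lintegral_add_right _ (hdm 0 M)).symm
      _ ≤ ∫⁻ ω, M * ∑ i ∈ Finset.range M, edist (ω i) (ω (i + 1)) ^ 2 ∂P := lintegral_mono hpt
      _ = M * ∑ i ∈ Finset.range M, ∫⁻ ω, edist (ω i) (ω (i + 1)) ^ 2 ∂P := by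
          rw [lintegral_const_mul _ (Finset.measurable_fun_sum _ fun i _ => hdm i (i + 1)),
            lintegral_finsetSum _ fun i _ => hdm i (i + 1)]
      _ ≤ M * ∑ i ∈ Finset.range M, (w + η) := by
          gcongr with i hi
          rw [Finset.mem_range] at hi
          have h := (hπ i hi).2.2
          rw [← hPπ i hi, lintegral_map hsqmeas (by fun_prop)] at h
          exact h.le
      _ = (M * M) * η + (M * M) * w := by
          rw [Finset.sum_const, Finset.card_range, nsmul_eq_mul]; ring
      _ = a * ε + W := by
          rw [hη, hw, ENNReal.mul_div_cancel (mul_ne_zero hMe hMe) (ENNReal.mul_ne_top hMt hMt),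
            ENNReal.mul_div_cancel (mul_ne_zero hMe hMe) (ENNReal.mul_ne_top hMt hMt)]
  have h3 := (ENNReal.add_le_add_iff_right hW).1 hint
  exact (measure_mono hbad).trans ((ENNReal.mul_le_mul_iff_right ha0 hat).1 h3)

theorem exists_geodesic_of_dyadic [MetricSpace X] [CompleteSpace X] (y : ℚ → X)
    (h : ∀ n i j : ℕ, i ≤ j → j ≤ 2 ^ n →
      dist (y (i / 2 ^ n)) (y (j / 2 ^ n)) ≤ ((j : ℝ) - i) / 2 ^ n * dist (y 0) (y 1)) :
    ∃ γ : GeoSpace X, ∀ n j : ℕ, j ≤ 2 ^ n → geval γ ((j : ℝ) / 2 ^ n) = y (j / 2 ^ n) := by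
  set L := dist (y 0) (y 1) with hL
  have hgrid : ∀ n i j : ℕ, i ≤ j → j ≤ 2 ^ n →
      dist (y (i / 2 ^ n)) (y (j / 2 ^ n)) = ((j : ℝ) - i) / 2 ^ n * L := by
    intro n i j hij hj
    refine le_antisymm (h n i j hij hj) ?_
    have h1 := h n 0 i (Nat.zero_le _) (hij.trans hj)
    have h2 := h n j (2 ^ n) hj le_rfl
    have h3 := dist_triangle4 (y 0) (y (i / 2 ^ n)) (y (j / 2 ^ n)) (y 1)
    simp only [Nat.cast_zero, zero_div, Nat.cast_pow, Nat.cast_ofNat, sub_zero] at h1 h2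
    rw [div_self (by positivity : (2 ^ n : ℚ) ≠ 0)] at h2
    have h4 : (i : ℝ) / 2 ^ n * L + ((j : ℝ) - i) / 2 ^ n * L + (2 ^ n - (j : ℝ)) / 2 ^ n * L
        = L := by
      field_simp
      ring
    linarith
  have hdist : ∀ n m i j : ℕ, i ≤ 2 ^ n → j ≤ 2 ^ m →
      dist (y (i / 2 ^ n)) (y (j / 2 ^ m)) = |(i : ℝ) / 2 ^ n - (j : ℝ) / 2 ^ m| * L := by
    have aux : ∀ n i j : ℕ, i ≤ 2 ^ n → j ≤ 2 ^ n →
        dist (y (i / 2 ^ n)) (y (j / 2 ^ n)) = |(i : ℝ) / 2 ^ n - (j : ℝ) / 2 ^ n| * L := by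
      intro n i j hi hj
      rcases le_total i j with hij | hij
      · have : (i : ℝ) ≤ j := by exact_mod_cast hij
        rw [hgrid n i j hij hj, ← sub_div, abs_div, abs_sub_comm, abs_of_nonneg (by linarith),
          abs_of_pos (by positivity)]
      · have : (j : ℝ) ≤ i := by exact_mod_cast hij
        rw [dist_comm, hgrid n j i hij hi, ← sub_div, abs_div, abs_of_nonneg (by linarith),
          abs_of_pos (by positivity)]
    intro n m i j hi hj
    have key := aux (n + m) (i * 2 ^ m) (j * 2 ^ n)
      (by rw [pow_add]; exact Nat.mul_le_mul_right _ hi)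
      (by rw [pow_add, mul_comm]; exact Nat.mul_le_mul_left _ hj)
    have e1 : ((i * 2 ^ m : ℕ) : ℚ) / 2 ^ (n + m) = i / 2 ^ n := by
      push_cast; rw [pow_add]; field_simp
    have e2 : ((j * 2 ^ n : ℕ) : ℚ) / 2 ^ (n + m) = j / 2 ^ m := by
      push_cast; rw [pow_add]; field_simp
    have e3 : ((i * 2 ^ m : ℕ) : ℝ) / 2 ^ (n + m) = i / 2 ^ n := by
      push_cast; rw [pow_add]; field_simp
    have e4 : ((j * 2 ^ n : ℕ) : ℝ) / 2 ^ (n + m) = j / 2 ^ m := by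
      push_cast; rw [pow_add]; field_simp
    rwa [e1, e2, e3, e4] at key
  have hL0 : 0 ≤ L := dist_nonneg
  set k : unitInterval → ℕ → ℕ := fun t n => ⌊(t : ℝ) * 2 ^ n⌋₊ with hk
  have hk2 : ∀ t n, k t n ≤ 2 ^ n := by
    intro t n
    refine Nat.floor_le_of_le ?_
    push_cast
    exact mul_le_of_le_one_left (by positivity) t.2.2
  have htend : ∀ t, Tendsto (fun n => (k t n : ℝ) / 2 ^ n) atTop (𝓝 (t : ℝ)) := by
    intro t
    exact (tendsto_nat_floor_mul_div_atTop t.2.1).comp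
      (tendsto_pow_atTop_atTop_of_one_lt (one_lt_two : (1 : ℝ) < 2))
  have hlim : ∀ t, ∃ x, Tendsto (fun n => y (k t n / 2 ^ n)) atTop (𝓝 x) := by
    intro t
    refine cauchySeq_tendsto_of_complete ?_
    have hc := (htend t).cauchySeq
    rw [Metric.cauchySeq_iff] at hc ⊢
    intro ε hε
    obtain ⟨n, hn⟩ := hc (ε / (L + 1)) (by positivity)
    refine ⟨n, fun a ha b hb => ?_⟩
    rw [hdist a b _ _ (hk2 t a) (hk2 t b)]
    have := hn a ha b hb
    rw [Real.dist_eq, lt_div_iff₀ (by positivity)] at this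
    refine lt_of_le_of_lt ?_ this
    gcongr
    linarith
  choose γ hγ using hlim
  have hγd : ∀ s t, dist (γ s) (γ t) = |(s : ℝ) - t| * L := by
    intro s t
    refine tendsto_nhds_unique ((hγ s).dist (hγ t)) ?_
    simp only [fun n => hdist n n _ _ (hk2 s n) (hk2 t n)]
    exact (((htend s).sub (htend t)).abs).mul_const L
  have hγy : ∀ n j : ℕ, (hj : j ≤ 2 ^ n) → ∀ t : unitInterval, (t : ℝ) = j / 2 ^ n →
      γ t = y (j / 2 ^ n) := by
    intro n j hj t ht
    rw [← dist_eq_zero]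
    refine tendsto_nhds_unique ((hγ t).dist tendsto_const_nhds) ?_
    simp only [fun m => hdist m n _ _ (hk2 t m) hj]
    have := (((htend t).sub_const ((j : ℝ) / 2 ^ n)).abs).mul_const L
    rwa [ht, sub_self, abs_zero, zero_mul] at this
  have hγ01 : dist (γ 0) (γ 1) = L := by rw [hγd]; simp
  have hcont : Continuous γ := by
    refine (LipschitzWith.of_dist_le_mul (K := ⟨L, hL0⟩) fun s t => ?_).continuous
    rw [hγd, mul_comm]
    rfl
  refine ⟨⟨⟨γ, hcont⟩, fun s t => ?_⟩, fun n j hj => ?_⟩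
  · change dist (γ s) (γ t) = _ * dist (γ 0) (γ 1)
    rw [hγ01, hγd]
  · have hmem : ((j : ℝ) / 2 ^ n) ∈ Set.Icc (0 : ℝ) 1 := by
      refine ⟨by positivity, ?_⟩
      rw [div_le_one (by positivity)]
      exact_mod_cast hj
    refine hγy n j hj _ ?_
    rw [Set.projIcc_of_mem _ hmem]

/-- Families of points indexed by rational times, lying in prescribed sets, which along the dyadic
grid of order `n` form a geodesic up to an error `(1/2)^n`. -/
def approxGeodesics [MetricSpace X] (K : ℚ → Set X) (n : ℕ) : Set (ℚ → X) :=
  {y | y ∈ Set.pi Set.univ K ∧ ∀ i j : ℕ, i ≤ j → j ≤ 2 ^ n →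
    dist (y (i / 2 ^ n)) (y (j / 2 ^ n))
      ≤ ((j : ℝ) - i) / 2 ^ n * dist (y 0) (y 1) + (1 / 2) ^ n}

theorem isCompact_approxGeodesics [MetricSpace X] {K : ℚ → Set X} (hK : ∀ q, IsCompact (K q))
    (n : ℕ) : IsCompact (approxGeodesics K n) := by
  refine (isCompact_univ_pi hK).inter_right (t := {y | ∀ i j : ℕ, i ≤ j → j ≤ 2 ^ n →
    dist (y (i / 2 ^ n)) (y (j / 2 ^ n))
      ≤ ((j : ℝ) - i) / 2 ^ n * dist (y 0) (y 1) + (1 / 2) ^ n}) ?_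
  simp only [Set.ofPred_forall]
  refine isClosed_iInter fun i => isClosed_iInter fun j => isClosed_iInter fun _ =>
    isClosed_iInter fun _ => ?_
  exact isClosed_le (by fun_prop) (by fun_prop)

theorem antitone_approxGeodesics [MetricSpace X] (K : ℚ → Set X) :
    Antitone (approxGeodesics K) := by
  refine antitone_nat_of_succ_le fun n => ?_
  rintro y ⟨hyK, hy⟩
  refine ⟨hyK, fun i j hij hj => ?_⟩
  have h := hy (i * 2) (j * 2) (Nat.mul_le_mul_right _ hij)
    (by rw [pow_succ]; exact Nat.mul_le_mul_right _ hj)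
  have e : ∀ l : ℕ, ((l * 2 : ℕ) : ℚ) / 2 ^ (n + 1) = l / 2 ^ n := fun l => by
    push_cast; rw [pow_succ]; field_simp
  have e' : (((j * 2 : ℕ) : ℝ) - (i * 2 : ℕ)) / 2 ^ (n + 1) = ((j : ℝ) - i) / 2 ^ n := by
    push_cast; rw [pow_succ]; field_simp
  rw [e, e, e'] at h
  refine h.trans ?_
  refine add_le_add_right ?_ _
  exact pow_le_pow_of_le_one (by norm_num) (by norm_num) (Nat.le_succ n)

theorem iInter_image_approxGeodesics_subset_Zt [MetricSpace X] [CompleteSpace X]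
    {K : ℚ → Set X} (hK : ∀ q, IsCompact (K q)) (k : ℕ) :
    ⋂ n, (fun y : ℚ → X => y (1 / 2 ^ k)) '' approxGeodesics K n
      ⊆ Zt (1 / 2 ^ k) (K 0) (K 1) := by
  intro z hz
  rw [Set.mem_iInter] at hz
  have hcl : IsClosed {y : ℚ → X | y (1 / 2 ^ k) = z} :=
    isClosed_eq (by fun_prop) continuous_const
  obtain ⟨y, hy⟩ := IsCompact.nonempty_iInter_of_sequence_nonempty_isCompact_isClosed
    (fun n => approxGeodesics K n ∩ {y | y (1 / 2 ^ k) = z})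
    (fun n => Set.inter_subset_inter_left _ (antitone_approxGeodesics K (Nat.le_succ n)))
    (fun n => by obtain ⟨y, hy, hyz⟩ := hz n; exact ⟨y, hy, hyz⟩)
    ((isCompact_approxGeodesics hK 0).inter_right hcl)
    (fun n => (isCompact_approxGeodesics hK n).isClosed.inter hcl)
  rw [Set.mem_iInter] at hy
  have hyz : y (1 / 2 ^ k) = z := (hy 0).2
  obtain ⟨γ, hγ⟩ := exists_geodesic_of_dyadic y (by
    intro n i j hij hj
    have hlim : Tendsto (fun m : ℕ => ((j : ℝ) - i) / 2 ^ n * dist (y 0) (y 1) + (1 / 2) ^ m)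
        atTop (𝓝 (((j : ℝ) - i) / 2 ^ n * dist (y 0) (y 1) + 0)) :=
      tendsto_const_nhds.add (tendsto_pow_atTop_nhds_zero_of_lt_one (by norm_num) (by norm_num))
    rw [add_zero] at hlim
    refine ge_of_tendsto hlim ?_
    filter_upwards [eventually_ge_atTop n] with m hm
    obtain ⟨l, rfl⟩ := Nat.exists_eq_add_of_le hm
    have h := (hy (n + l)).1.2 (i * 2 ^ l) (j * 2 ^ l) (Nat.mul_le_mul_right _ hij)
      (by rw [pow_add]; exact Nat.mul_le_mul_right _ hj)
    have e : ∀ a : ℕ, ((a * 2 ^ l : ℕ) : ℚ) / 2 ^ (n + l) = a / 2 ^ n := fun a => by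
      push_cast; rw [pow_add]; field_simp
    have e' : (((j * 2 ^ l : ℕ) : ℝ) - (i * 2 ^ l : ℕ)) / 2 ^ (n + l) = ((j : ℝ) - i) / 2 ^ n := by
      push_cast; rw [pow_add]; field_simp
    rwa [e, e, e'] at h)
  have hyK : ∀ q, y q ∈ K q := fun q => (hy 0).1.1 q (Set.mem_univ q)
  refine ⟨γ, ?_, ?_, ?_⟩
  · have := hγ 0 0 (by simp)
    simp only [Nat.cast_zero, zero_div] at this
    rw [this]; exact hyK 0
  · have := hγ 0 1 (by simp)
    simp only [Nat.cast_one, pow_zero, div_one] at this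
    rw [this]; exact hyK 1
  · have := hγ k 1 Nat.one_le_two_pow
    simp only [Nat.cast_one] at this
    rw [this, hyz]

theorem exists_mem_approxGeodesics [MetricSpace X] {K : ℚ → Set X} (hK : ∀ q, (K q).Nonempty)
    (n : ℕ) (ω : ℕ → X) (hωK : ∀ i : ℕ, i ≤ 2 ^ n → ω i ∈ K (i / 2 ^ n))
    (hω : ∀ i < 2 ^ n, dist (ω i) (ω (i + 1)) ≤ dist (ω 0) (ω (2 ^ n)) / 2 ^ n + (1 / 4) ^ n) :
    ∃ y ∈ approxGeodesics K n, ∀ i : ℕ, i ≤ 2 ^ n → y (i / 2 ^ n) = ω i := by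
  classical
  choose z hz using hK
  set y : ℚ → X := fun q =>
    if h : ∃ i : ℕ, i ≤ 2 ^ n ∧ (i : ℚ) / 2 ^ n = q then ω h.choose else z q with hy
  have hyω : ∀ i : ℕ, i ≤ 2 ^ n → y (i / 2 ^ n) = ω i := by
    intro i hi
    have h : ∃ l : ℕ, l ≤ 2 ^ n ∧ (l : ℚ) / 2 ^ n = i / 2 ^ n := ⟨i, hi, rfl⟩
    have h2 := h.choose_spec.2
    rw [div_left_inj' (by positivity)] at h2
    simp only [hy]
    rw [dif_pos h, Nat.cast_injective h2]
  refine ⟨y, ⟨fun q _ => ?_, fun i j hij hj => ?_⟩, hyω⟩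
  · by_cases h : ∃ i : ℕ, i ≤ 2 ^ n ∧ (i : ℚ) / 2 ^ n = q
    · obtain ⟨i, hi, rfl⟩ := h
      rw [hyω i hi]
      exact hωK i hi
    · simp only [hy]
      rw [dif_neg h]
      exact hz q
  · have h0 : y 0 = ω 0 := by simpa using hyω 0 (Nat.zero_le _)
    have h1 : y 1 = ω (2 ^ n) := by simpa using hyω (2 ^ n) le_rfl
    rw [hyω i (hij.trans hj), hyω j hj, h0, h1]
    have hsum := dist_le_Ico_sum_of_dist_le (f := ω) hij
      (d := fun _ => dist (ω 0) (ω (2 ^ n)) / 2 ^ n + (1 / 4) ^ n)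
      (fun _ hl => hω _ (hl.trans_le hj))
    rw [Finset.sum_const, Nat.card_Ico, nsmul_eq_mul, Nat.cast_sub hij] at hsum
    refine hsum.trans ?_
    have hji : (j : ℝ) - i ≤ 2 ^ n := by
      have h2 : (j : ℝ) ≤ 2 ^ n := by exact_mod_cast hj
      have h3 : (0 : ℝ) ≤ i := Nat.cast_nonneg i
      linarith
    have h4 : ((j : ℝ) - i) * (1 / 4) ^ n ≤ (1 / 2) ^ n := by
      calc ((j : ℝ) - i) * (1 / 4) ^ n ≤ 2 ^ n * (1 / 4) ^ n := by gcongr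
        _ = (1 / 2) ^ n := by rw [← mul_pow]; norm_num
    calc ((j : ℝ) - i) * (dist (ω 0) (ω (2 ^ n)) / 2 ^ n + (1 / 4) ^ n)
        = ((j : ℝ) - i) / 2 ^ n * dist (ω 0) (ω (2 ^ n)) + ((j : ℝ) - i) * (1 / 4) ^ n := by ring
      _ ≤ _ := by gcongr

theorem IsW2Geo.measure_compl_image_approxGeodesics_le [MetricSpace X] [MeasurableSpace X]
    [BorelSpace X] [CompleteSpace X] [SecondCountableTopology X] {μ : ℝ → Measure X}
    (hμ : IsW2Geo μ) (hW : W2sq (μ 0) (μ 1) ≠ ⊤) {K : ℚ → Set X} (hK : ∀ q, IsCompact (K q))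
    (hKne : ∀ q, (K q).Nonempty) {e : ℚ → ℝ≥0∞}
    (hKe : ∀ q : ℚ, 0 ≤ q → q ≤ 1 → μ q (K q)ᶜ ≤ e q) {ε : ℝ≥0∞} (hε : ε ≠ 0) {k n : ℕ}
    (hkn : k ≤ n) :
    μ (1 / 2 ^ k) ((fun y : ℚ → X => y (1 / 2 ^ k)) '' approxGeodesics K n)ᶜ
      ≤ ∑' q, e q + ε := by
  obtain ⟨P, hP, hPμ, hPbad⟩ := hμ.exists_chain hW (2 ^ n) (by positivity) ((1 / 4) ^ n)
    (by positivity) ε hε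
  set S := (fun y : ℚ → X => y (1 / 2 ^ k)) '' approxGeodesics K n with hS
  have hSm : MeasurableSet S :=
    ((isCompact_approxGeodesics hK n).image (by fun_prop)).measurableSet
  obtain ⟨l, rfl⟩ := Nat.exists_eq_add_of_le hkn
  have hl : (2 : ℕ) ^ l ≤ 2 ^ (k + l) := Nat.pow_le_pow_right (by norm_num) (by omega)
  have htime : (((2 ^ l : ℕ) : ℝ) / ((2 ^ (k + l) : ℕ) : ℝ)) = 1 / 2 ^ k := by
    push_cast; rw [pow_add]; field_simp
  have htimeq : (((2 ^ l : ℕ) : ℚ) / 2 ^ (k + l)) = 1 / 2 ^ k := by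
    push_cast; rw [pow_add]; field_simp
  rw [← htime, ← hPμ _ hl, Measure.map_apply (by fun_prop) hSm.compl]
  set bad := {ω : ℕ → X | ∃ i < 2 ^ (k + l), dist (ω 0) (ω (2 ^ (k + l))) / ((2 ^ (k + l) : ℕ) : ℝ)
    + (1 / 4) ^ (k + l) < dist (ω i) (ω (i + 1))} with hbad
  have hsub : (fun ω : ℕ → X => ω (2 ^ l)) ⁻¹' Sᶜ
      ⊆ (⋃ i ∈ Finset.range (2 ^ (k + l) + 1), (fun ω : ℕ → X => ω i) ⁻¹' (K (i / 2 ^ (k + l)))ᶜ)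
        ∪ bad := by
    intro ω hω
    by_contra hcon
    simp only [Set.mem_union, Set.mem_iUnion, Finset.mem_range, Set.mem_preimage,
      Set.mem_compl_iff, not_or, not_exists, not_not, hbad, Set.mem_ofPred_eq, not_and,
      not_lt] at hcon
    obtain ⟨y, hyC, hy⟩ := exists_mem_approxGeodesics hKne (k + l) ω
      (fun i hi => hcon.1 i (by omega)) (fun i hi => by simpa using hcon.2 i hi)
    exact hω ⟨y, hyC, by simpa only [htimeq] using hy _ hl⟩
  calc P ((fun ω : ℕ → X => ω (2 ^ l)) ⁻¹' Sᶜ)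
      ≤ P (⋃ i ∈ Finset.range (2 ^ (k + l) + 1),
          (fun ω : ℕ → X => ω i) ⁻¹' (K (i / 2 ^ (k + l)))ᶜ) + P bad :=
        (measure_mono hsub).trans (measure_union_le _ _)
    _ ≤ ∑ i ∈ Finset.range (2 ^ (k + l) + 1), e (i / 2 ^ (k + l)) + ε := by
        refine add_le_add ((measure_biUnion_finset_le _ _).trans (Finset.sum_le_sum ?_)) hPbad
        intro i hi
        have hi' : i ≤ 2 ^ (k + l) := by rw [Finset.mem_range] at hi; omega
        rw [← Measure.map_apply (by fun_prop) (hK _).measurableSet.compl, hPμ i hi']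
        have h := hKe ((i : ℚ) / 2 ^ (k + l)) (by positivity)
          (by rw [div_le_one (by positivity)]; exact_mod_cast hi')
        push_cast at h ⊢
        exact h
    _ ≤ ∑' q, e q + ε := by
        gcongr
        rw [← Finset.sum_image (f := e) (g := fun i : ℕ => (i : ℚ) / 2 ^ (k + l))]
        · exact ENNReal.sum_le_tsum _
        · intro i _ j _ hij
          exact Nat.cast_injective ((div_left_inj' (by positivity)).1 hij)

theorem IsW2Geo.exists_measurableSet_subset_Zt [MetricSpace X] [MeasurableSpace X]
    [BorelSpace X] [CompleteSpace X] [SecondCountableTopology X] {μ : ℝ → Measure X}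
    (hμ : IsW2Geo μ) (hW : W2sq (μ 0) (μ 1) ≠ ⊤) {A0 A1 : Set X} (hA0 : IsCompact A0)
    (hA1 : IsCompact A1) (h0 : μ 0 A0ᶜ = 0) (h1 : μ 1 A1ᶜ = 0) (k : ℕ) :
    ∃ T, MeasurableSet T ∧ T ⊆ Zt (1 / 2 ^ k) A0 A1 ∧ μ (1 / 2 ^ k) Tᶜ = 0 := by
  have key : ∀ ε : ℝ≥0∞, ε ≠ 0 →
      ∃ T, MeasurableSet T ∧ T ⊆ Zt (1 / 2 ^ k) A0 A1 ∧ μ (1 / 2 ^ k) Tᶜ ≤ ε := by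
    intro ε hε
    have hε2 : ε / 2 ≠ 0 := (ENNReal.half_pos hε).ne'
    obtain ⟨e, he0, hesum⟩ := ENNReal.exists_pos_sum_of_countable hε2 ℚ
    have hne : ∀ t ∈ Set.Icc (0 : ℝ) 1, ∀ A : Set X, μ t Aᶜ = 0 → A.Nonempty := by
      intro t ht A hA
      have := hμ.prob t ht
      by_contra hcon
      rw [Set.not_nonempty_iff_eq_empty] at hcon
      simp [hcon] at hA
    obtain ⟨x0, -⟩ := hne 0 (by simp) A0 h0
    have hKex : ∀ q : ℚ, ∃ K : Set X, IsCompact K ∧ K.Nonempty ∧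
        (0 ≤ q → q ≤ 1 → μ q Kᶜ ≤ e q) ∧ (q = 0 → K ⊆ A0) ∧ (q = 1 → K ⊆ A1) := by
      intro q
      by_cases hq0 : q = 0
      · subst hq0
        exact ⟨A0, hA0, hne 0 (by simp) A0 h0, fun _ _ => by simp [h0], fun _ => le_rfl,
          fun h => by norm_num at h⟩
      by_cases hq1 : q = 1
      · subst hq1
        exact ⟨A1, hA1, hne 1 (by simp) A1 h1, fun _ _ => by simp [h1], fun h => by norm_num at h,
          fun _ => le_rfl⟩
      by_cases hq : 0 ≤ q ∧ q ≤ 1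
      · have hprob := hμ.prob (q : ℝ) ⟨by exact_mod_cast hq.1, by exact_mod_cast hq.2⟩
        obtain ⟨K, -, hK, hKm⟩ := (MeasurableSet.univ (α := X)).exists_isCompact_sdiff_lt
          (μ := μ (q : ℝ)) (measure_ne_top _ _)
          (ε := (e q : ℝ≥0∞)) (by exact_mod_cast (he0 q).ne')
        refine ⟨insert x0 K, hK.insert x0, Set.insert_nonempty _ _, fun _ _ => ?_,
          fun h => absurd h hq0, fun h => absurd h hq1⟩
        refine (measure_mono ?_).trans hKm.le
        intro z hz
        exact ⟨Set.mem_univ z, fun h => hz (Set.mem_insert_of_mem _ h)⟩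
      · exact ⟨{x0}, isCompact_singleton, Set.singleton_nonempty _,
          fun ha hb => absurd ⟨ha, hb⟩ hq, fun h => absurd h hq0, fun h => absurd h hq1⟩
    choose K hK hKne hKe hK0 hK1 using hKex
    set S := fun n => (fun y : ℚ → X => y (1 / 2 ^ k)) '' approxGeodesics K n with hS
    have hSm : ∀ n, MeasurableSet (S n) := fun n =>
      ((isCompact_approxGeodesics hK n).image (by fun_prop)).measurableSet
    have hSanti : Antitone S := fun a b hab =>
      Set.image_mono (antitone_approxGeodesics K hab)
    refine ⟨⋂ n, S n, MeasurableSet.iInter hSm, ?_, ?_⟩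
    · refine (iInter_image_approxGeodesics_subset_Zt hK k).trans ?_
      rintro z ⟨γ, ha, hb, hc⟩
      exact ⟨γ, hK0 0 rfl ha, hK1 1 rfl hb, hc⟩
    · rw [Set.compl_iInter, Monotone.measure_iUnion fun a b hab =>
        Set.compl_subset_compl.2 (hSanti hab)]
      refine iSup_le fun n => ?_
      calc μ (1 / 2 ^ k) (S n)ᶜ ≤ μ (1 / 2 ^ k) (S (max n k))ᶜ :=
            measure_mono (Set.compl_subset_compl.2 (hSanti (le_max_left n k)))
        _ ≤ ∑' q, (e q : ℝ≥0∞) + ε / 2 :=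
            hμ.measure_compl_image_approxGeodesics_le hW hK hKne hKe hε2 (le_max_right n k)
        _ ≤ ε / 2 + ε / 2 := by gcongr
        _ = ε := ENNReal.add_halves ε
  have hpos : ∀ n : ℕ, ((n : ℝ≥0∞) + 1)⁻¹ ≠ 0 := fun n =>
    ENNReal.inv_ne_zero.2 (by finiteness)
  choose T hTm hTZ hTε using fun n : ℕ => key _ (hpos n)
  refine ⟨⋃ n, T n, MeasurableSet.iUnion hTm, Set.iUnion_subset hTZ, ?_⟩
  have hlim : Tendsto (fun n : ℕ => ((n : ℝ≥0∞) + 1)⁻¹) atTop (𝓝 0) := by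
    have := ENNReal.tendsto_inv_nat_nhds_zero.comp (tendsto_add_atTop_nat 1)
    simpa [Function.comp_def] using this
  refine le_antisymm (ge_of_tendsto' hlim fun n => ?_) zero_le
  exact (measure_mono (Set.compl_subset_compl.2 (Set.subset_iUnion T n))).trans (hTε n)

theorem epos_coe (r : ℝ) : epos (r : EReal) = ENNReal.ofReal r := by
  simp [epos]

theorem epos_mono : Monotone epos := by
  intro x y hxy
  by_cases hy : y = ⊤
  · simp [epos, hy]
  · have hx : x ≠ ⊤ := fun h => hy (top_le_iff.1 (h ▸ hxy))
    by_cases hxb : x = ⊥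
    · simp [epos, hxb]
    · simp only [epos, hx, hy, if_false]
      exact ENNReal.ofReal_le_ofReal (EReal.toReal_le_toReal hxy hxb hy)

theorem lintegral_le_of_le_on_of_null {α : Type*} [MeasurableSpace α] (ν : Measure α)
    [IsProbabilityMeasure ν] (f : α → ℝ≥0∞) (E : Set α) (c : ℝ≥0∞)
    (hE : ∀ S, MeasurableSet S → Disjoint S E → ν S = 0) (hf : ∀ y ∈ E, f y ≤ c) :
    ∫⁻ y, f y ∂ν ≤ c := by
  obtain ⟨g, hg, hgf, hint⟩ := exists_measurable_le_lintegral_eq ν f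
  have hS : MeasurableSet {y | c < g y} := measurableSet_lt measurable_const hg
  have hdis : Disjoint {y | c < g y} E := by
    rw [Set.disjoint_left]
    exact fun y hy hyE => absurd (hy.trans_le ((hgf y).trans (hf y hyE))) (lt_irrefl _)
  have hae : ∀ᵐ y ∂ν, g y ≤ c := by
    rw [ae_iff]
    simpa only [not_le] using hE _ hS hdis
  rw [hint]
  calc ∫⁻ y, g y ∂ν ≤ ∫⁻ _, c ∂ν := lintegral_mono_ae hae
    _ = c := by simp

theorem le_exp_eintegral_log {α : Type*} [MeasurableSpace α] (ν : Measure α)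
    [IsProbabilityMeasure ν] (f : α → ℝ≥0∞) (E : Set α) {c : ℝ} (hc0 : 0 < c) (hc1 : c ≤ 1)
    (hE : ∀ S, MeasurableSet S → Disjoint S E → ν S = 0)
    (hf : ∀ y ∈ E, ENNReal.ofReal c ≤ f y) :
    ENNReal.ofReal c ≤
      EReal.exp ((((1 : ℝ)⁻¹ : ℝ) : EReal) * eintegral ν fun y => ENNReal.log (f y)) := by
  have hneg : ∫⁻ y, epos (-(ENNReal.log (f y))) ∂ν ≤ ENNReal.ofReal (-Real.log c) := by
    refine lintegral_le_of_le_on_of_null ν _ E _ hE fun y hy => ?_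
    rw [← epos_coe, EReal.coe_neg, ← ENNReal.log_ofReal_of_pos hc0]
    exact epos_mono (EReal.neg_le_neg_iff.2 (ENNReal.log_monotone (hf y hy)))
  have hlog : -Real.log c ≥ 0 := by
    have := Real.log_nonpos hc0.le hc1
    linarith
  have hle : ((Real.log c : ℝ) : EReal) ≤ eintegral ν fun y => ENNReal.log (f y) := by
    have h1 : ((∫⁻ y, epos (-(ENNReal.log (f y))) ∂ν : ℝ≥0∞) : EReal)
        ≤ ((-Real.log c : ℝ) : EReal) := by
      refine (EReal.coe_ennreal_le_coe_ennreal_iff.2 hneg).trans ?_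
      rw [EReal.coe_ennreal_ofReal, max_eq_left hlog]
    have h2 := EReal.sub_le_sub
      (EReal.coe_ennreal_nonneg (∫⁻ y, epos (ENNReal.log (f y)) ∂ν)) h1
    refine le_trans (le_of_eq ?_) h2
    rw [← EReal.coe_zero, ← EReal.coe_sub]
    simp
  have h3 := EReal.exp_monotone hle
  rw [EReal.exp_coe, Real.exp_log hc0] at h3
  simpa using h3

theorem UnE_one_le_of_measure_compl_eq_zero [MeasurableSpace X] (μ m : Measure X)
    [IsProbabilityMeasure μ] [SigmaFinite m] {T : Set X} (hT : MeasurableSet T)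
    (hμT : μ Tᶜ = 0) : UnE 1 μ m ≤ m T := by
  by_cases hTtop : m T = ⊤
  · simp [hTtop]
  by_cases hEnt : μ ≪ m ∧
      Integrable (fun x => (μ.rnDeriv m x).toReal * Real.log (μ.rnDeriv m x).toReal) m
  swap
  · simp [UnE, Ent, hEnt]
  obtain ⟨hac, hint⟩ := hEnt
  have hμT1 : μ T = 1 := (prob_compl_eq_zero_iff hT).1 hμT
  have hT0 : m T ≠ 0 := fun h => by simp [hac h] at hμT1
  set v : ℝ := (m T).toReal with hv
  have hv0 : 0 < v := ENNReal.toReal_pos hT0 hTtop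
  have hae : ∀ᵐ x ∂m, x ∉ T →
      (μ.rnDeriv m x).toReal * Real.log (μ.rnDeriv m x).toReal = 0 := by
    have h := Measure.setLIntegral_rnDeriv hac Tᶜ
    rw [hμT, lintegral_eq_zero_iff (Measure.measurable_rnDeriv μ m)] at h
    rw [Filter.EventuallyEq, ae_restrict_iff' hT.compl] at h
    filter_upwards [h] with x hx hxT
    rw [hx hxT]
    simp
  have hTint : ∫ x in T, (μ.rnDeriv m x).toReal * Real.log (μ.rnDeriv m x).toReal ∂m
      = ∫ x, (μ.rnDeriv m x).toReal * Real.log (μ.rnDeriv m x).toReal ∂m :=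
    setIntegral_eq_integral_of_ae_compl_eq_zero hae
  have hρint : Integrable (fun x => (μ.rnDeriv m x).toReal) (m.restrict T) :=
    Measure.integrable_toReal_rnDeriv.restrict
  have hconst : Integrable (fun _ : X => v⁻¹) (m.restrict T) := by
    have : IsFiniteMeasure (m.restrict T) := ⟨by simpa using lt_top_iff_ne_top.2 hTtop⟩
    exact integrable_const _
  have hρ1 : ∫ x in T, (μ.rnDeriv m x).toReal ∂m = 1 := by
    rw [Measure.setIntegral_toReal_rnDeriv hac, measureReal_def, hμT1]
    simp
  have hle : -Real.log v
      ≤ ∫ x, (μ.rnDeriv m x).toReal * Real.log (μ.rnDeriv m x).toReal ∂m := by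
    rw [← hTint]
    calc -Real.log v
        = ∫ x in T, ((μ.rnDeriv m x).toReal * (Real.log v⁻¹ + 1) - v⁻¹) ∂m := by
          rw [integral_sub (hρint.mul_const _) hconst, integral_mul_const, hρ1, setIntegral_const,
            measureReal_def, ← hv, Real.log_inv, smul_eq_mul, mul_inv_cancel₀ hv0.ne']
          ring
      _ ≤ _ := by
          refine integral_mono ((hρint.mul_const _).sub hconst) hint.restrict fun x => ?_
          change (μ.rnDeriv m x).toReal * (Real.log v⁻¹ + 1) - v⁻¹
            ≤ (μ.rnDeriv m x).toReal * Real.log (μ.rnDeriv m x).toReal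
          rcases (ENNReal.toReal_nonneg (a := μ.rnDeriv m x)).eq_or_lt with h | h
          · rw [← h]
            simp [hv0.le]
          · have h1 := Real.one_sub_inv_le_log_of_pos (mul_pos h hv0)
            rw [Real.log_mul h.ne' hv0.ne'] at h1
            have h2 := mul_le_mul_of_nonneg_left h1 h.le
            rw [mul_sub, mul_inv, mul_inv_cancel_left₀ h.ne'] at h2
            rw [Real.log_inv]
            linarith
  have hEnteq : Ent μ m
      = ((∫ x, (μ.rnDeriv m x).toReal * Real.log (μ.rnDeriv m x).toReal ∂m : ℝ) : EReal) := by
    rw [Ent, if_pos ⟨hac, hint⟩]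
  rw [UnE, hEnteq, inv_one, EReal.coe_one, one_mul, ← EReal.coe_neg, EReal.exp_coe,
    ← ENNReal.ofReal_toReal hTtop]
  refine ENNReal.ofReal_le_ofReal ?_
  calc _ ≤ Real.exp (Real.log v) := Real.exp_le_exp.2 (by linarith)
    _ = v := Real.exp_log hv0

theorem Ent_normalized_restrict [MeasurableSpace X] (m : Measure X) [SigmaFinite m] {A : Set X}
    (hA : MeasurableSet A) (h0 : m A ≠ 0) (ht : m A ≠ ⊤) :
    Ent ((m A)⁻¹ • m.restrict A) m = ((-Real.log (m A).toReal : ℝ) : EReal) := by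
  have : IsFiniteMeasure (m.restrict A) := ⟨by simpa using lt_top_iff_ne_top.2 ht⟩
  set v : ℝ := (m A).toReal with hv
  have hv0 : 0 < v := ENNReal.toReal_pos h0 ht
  have hrn : (fun x => ((((m A)⁻¹ • m.restrict A).rnDeriv m x).toReal
      * Real.log (((m A)⁻¹ • m.restrict A).rnDeriv m x).toReal))
      =ᵐ[m] A.indicator fun _ => v⁻¹ * Real.log v⁻¹ := by
    filter_upwards [Measure.rnDeriv_smul_left_of_ne_top (m.restrict A) m
      (ENNReal.inv_ne_top.2 h0), Measure.rnDeriv_restrict_self m hA] with x h1 h2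
    rw [h1, Pi.smul_apply, h2]
    by_cases hx : x ∈ A <;> simp [hx, ENNReal.toReal_inv, ← hv]
  have hint : Integrable (A.indicator fun _ => v⁻¹ * Real.log v⁻¹) m := by
    rw [integrable_indicator_iff hA]
    exact integrable_const _
  have hac : (m A)⁻¹ • m.restrict A ≪ m :=
    Measure.smul_absolutelyContinuous.trans Measure.absolutelyContinuous_restrict
  rw [Ent, if_pos ⟨hac, hint.congr hrn.symm⟩, integral_congr_ae hrn, integral_indicator hA,
    setIntegral_const, measureReal_def, ← hv, smul_eq_mul, mul_inv_cancel_left₀ hv0.ne',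
    Real.log_inv]

theorem UnE_one_normalized_restrict [MeasurableSpace X] (m : Measure X) [SigmaFinite m]
    {A : Set X} (hA : MeasurableSet A) (h0 : m A ≠ 0) (ht : m A ≠ ⊤) :
    UnE 1 ((m A)⁻¹ • m.restrict A) m = m A := by
  rw [UnE, Ent_normalized_restrict m hA h0 ht, inv_one, EReal.coe_one, one_mul, EReal.coe_neg,
    neg_neg, EReal.exp_coe, Real.exp_log (ENNReal.toReal_pos h0 ht), ENNReal.ofReal_toReal ht]

theorem DistortionData.exists_near_zero {s : ℝ → ℝ} {N : ℝ} (h : DistortionData s N) :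
    ∃ c δ : ℝ, 0 < c ∧ 0 < δ ∧ ∀ θ, 0 < θ → θ < δ →
      c / 2 * θ ^ N ≤ s θ ∧ s θ ≤ 3 * c / 2 * θ ^ N := by
  obtain ⟨c, hc, ho⟩ := h.asymp
  have hev := ho.bound (half_pos hc)
  rw [eventually_nhdsWithin_iff, Metric.eventually_nhds_iff] at hev
  obtain ⟨δ, hδ, hev⟩ := hev
  refine ⟨c, δ, hc, hδ, fun θ h0 h1 => ?_⟩
  have h2 := hev (y := θ) (by rwa [Real.dist_eq, sub_zero, abs_of_pos h0]) h0
  rw [Real.norm_eq_abs, Real.norm_eq_abs, abs_of_pos (Real.rpow_pos_of_pos h0 N), abs_le] at h2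
  constructor <;> linarith

theorem DistortionData.Dcal_pos {s : ℝ → ℝ} {N : ℝ} (h : DistortionData s N) : 0 < Dcal s := by
  obtain ⟨c, δ, hc, hδ, hs⟩ := h.exists_near_zero
  refine lt_of_lt_of_le (ENNReal.ofReal_pos.2 hδ) (le_sInf ?_)
  rintro _ ⟨θ, ⟨h0, hz⟩, rfl⟩
  refine ENNReal.ofReal_le_ofReal (le_of_not_gt fun hlt => ?_)
  have h1 := (hs θ h0 hlt).1
  have h2 := Real.rpow_pos_of_pos h0 N
  rw [hz] at h1
  have : 0 < c / 2 * θ ^ N := by positivity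
  linarith

theorem DistortionData.pos_of_lt_Dcal {s : ℝ → ℝ} {N : ℝ} (h : DistortionData s N) {θ : ℝ}
    (h0 : 0 < θ) (hθ : ENNReal.ofReal θ < Dcal s) : 0 < s θ := by
  obtain ⟨c, δ, hc, hδ, hs⟩ := h.exists_near_zero
  by_contra hneg
  rw [not_lt] at hneg
  set θ' := min (δ / 2) θ with hθ'
  have hθ'0 : 0 < θ' := lt_min (half_pos hδ) h0
  have hs' : 0 ≤ s θ' := by
    refine le_trans ?_ (hs θ' hθ'0 (lt_of_le_of_lt (min_le_left _ _) (half_lt_self hδ))).1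
    have := Real.rpow_pos_of_pos hθ'0 N
    positivity
  have hcont : ContinuousOn s (Set.Icc θ' θ) :=
    h.cont.mono fun y hy => hθ'0.le.trans hy.1
  obtain ⟨z, hz, hz0⟩ := intermediate_value_Icc' (min_le_right _ _) hcont ⟨hneg, hs'⟩
  have hle : Dcal s ≤ ENNReal.ofReal z :=
    sInf_le ⟨z, ⟨hθ'0.trans_le hz.1, hz0⟩, rfl⟩
  exact absurd (hθ.trans_le (hle.trans (ENNReal.ofReal_le_ofReal hz.2))) (lt_irrefl _)

theorem DistortionData.exists_upper_bound {s : ℝ → ℝ} {N : ℝ} (h : DistortionData s N) (R : ℝ) :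
    ∃ C : ℝ, 0 < C ∧ ∀ θ, 0 < θ → θ ≤ R → s θ ≤ C * θ ^ N := by
  obtain ⟨c, δ, hc, hδ, hs⟩ := h.exists_near_zero
  obtain ⟨B, hB⟩ := isCompact_Icc.exists_bound_of_continuousOn
    (h.cont.mono fun y (hy : y ∈ Set.Icc δ R) => hδ.le.trans hy.1)
  have hδN := Real.rpow_pos_of_pos hδ N
  have hN : 0 ≤ N := zero_le_one.trans h.one_le
  refine ⟨3 * c / 2 + |B| / δ ^ N, by positivity, fun θ h0 hR => ?_⟩
  have hθN := Real.rpow_pos_of_pos h0 N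
  rw [add_mul]
  rcases lt_or_ge θ δ with hlt | hge
  · have : 0 ≤ |B| / δ ^ N * θ ^ N := by positivity
    linarith [(hs θ h0 hlt).2]
  · have h1 : s θ ≤ |B| := (le_abs_self _).trans ((hB θ ⟨hge, hR⟩).trans (le_abs_self _))
    have h2 : |B| ≤ |B| / δ ^ N * θ ^ N := by
      rw [div_mul_eq_mul_div, le_div_iff₀ hδN]
      gcongr
    have : 0 ≤ 3 * c / 2 * θ ^ N := by positivity
    linarith

/-- A distortion coefficient is bounded below by a multiple of `t ^ N`, uniformly in the gauge on
bounded intervals. -/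
theorem DistortionData.exists_beta_lower_bound {s : ℝ → ℝ} {N : ℝ} (h : DistortionData s N)
    (R : ℝ) :
    ∃ K t₀ : ℝ, 0 < K ∧ K ≤ 1 ∧ 0 < t₀ ∧ ∀ t, 0 < t → t < t₀ → ∀ θ : ℝ≥0∞,
      θ ≤ ENNReal.ofReal R → ENNReal.ofReal (K * t ^ N) ≤ beta s N t θ := by
  obtain ⟨c, δ, hc, hδ, hs⟩ := h.exists_near_zero
  set R' : ℝ := max 1 R with hR'
  have hR'0 : 0 < R' := lt_of_lt_of_le one_pos (le_max_left _ _)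
  obtain ⟨C, hC, hCs⟩ := h.exists_upper_bound R'
  refine ⟨min 1 (c / 2 / C), δ / R', lt_min one_pos (by positivity), min_le_left _ _,
    by positivity, fun t ht ht0 θ hθ => ?_⟩
  have htN := Real.rpow_pos_of_pos ht N
  have hratio : ∀ φ : ℝ≥0∞, φ ≠ 0 → φ ≤ ENNReal.ofReal R → φ < Dcal s →
      ENNReal.ofReal (min 1 (c / 2 / C) * t ^ N)
        ≤ ENNReal.ofReal (s (t * φ.toReal) / s φ.toReal) := by
    intro φ hφ0 hφR hφD
    refine ENNReal.ofReal_le_ofReal ?_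
    have hφt : φ ≠ ⊤ := ne_top_of_lt hφD
    have hp : 0 < φ.toReal := ENNReal.toReal_pos hφ0 hφt
    have hpR : φ.toReal ≤ R' := by
      refine ENNReal.toReal_le_of_le_ofReal hR'0.le (hφR.trans ?_)
      exact ENNReal.ofReal_le_ofReal (le_max_right _ _)
    have hpos : 0 < s φ.toReal := h.pos_of_lt_Dcal hp (by rwa [ENNReal.ofReal_toReal hφt])
    have hpN := Real.rpow_pos_of_pos hp N
    have hup := hCs _ hp hpR
    have hlow := (hs (t * φ.toReal) (by positivity) (by
      calc t * φ.toReal ≤ t * R' := by gcongr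
        _ < δ := by rwa [lt_div_iff₀ hR'0] at ht0)).1
    rw [Real.mul_rpow ht.le hp.le] at hlow
    rw [le_div_iff₀ hpos]
    calc min 1 (c / 2 / C) * t ^ N * s φ.toReal
        ≤ c / 2 / C * t ^ N * (C * φ.toReal ^ N) := by
          gcongr
          exact min_le_right _ _
      _ = c / 2 * (t ^ N * φ.toReal ^ N) := by field_simp
      _ ≤ _ := hlow
  rw [beta]
  split_ifs with hθ0 hθD
  · refine ENNReal.ofReal_le_ofReal ?_
    exact mul_le_of_le_one_left htN.le (min_le_left _ _)
  · exact hratio θ hθ0 hθ hθD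
  · rw [not_lt] at hθD
    refine le_liminf_of_le ?_ ?_
    · isBoundedDefault
    · filter_upwards [Ioo_mem_nhdsLT h.Dcal_pos] with φ hφ
      exact hratio φ hφ.1.ne' (hφ.2.le.trans (hθD.trans hθ)) hφ.2

theorem FiniteOnBounded.isLocallyFiniteMeasure [PseudoMetricSpace X] [MeasurableSpace X]
    {m : Measure X} (hm : FiniteOnBounded m) : IsLocallyFiniteMeasure m :=
  ⟨fun x => ⟨Metric.ball x 1, Metric.ball_mem_nhds x one_pos, hm _ Metric.isBounded_ball⟩⟩

theorem mSupp_subset_of_measure_compl_eq_zero [PseudoMetricSpace X] [MeasurableSpace X]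
    {μ : Measure X} {A : Set X} (hA : IsClosed A) (hμ : μ Aᶜ = 0) : mSupp μ ⊆ A := by
  intro x hx
  by_contra hxA
  obtain ⟨r, hr, hball⟩ := Metric.isOpen_iff.1 hA.isOpen_compl x hxA
  exact (hx r hr).ne' (measure_mono_null hball hμ)

theorem mSupp_mono_of_absolutelyContinuous [PseudoMetricSpace X] [MeasurableSpace X]
    {μ m : Measure X} (h : μ ≪ m) : mSupp μ ⊆ mSupp m := fun _ hx r hr =>
  pos_iff_ne_zero.2 fun h0 => (hx r hr).ne' (h h0)

/-- A set of positive outer measure contained in a closed set of finite measure has full outer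
measure in some compact set of positive measure. -/
theorem exists_isCompact_full_outer_measure [MetricSpace X] [MeasurableSpace X] [BorelSpace X]
    [CompleteSpace X] [SecondCountableTopology X] (m : Measure X) {E F : Set X}
    (hF : IsClosed F) (hEF : E ⊆ F) (hE0 : m E ≠ 0) (hEt : m E ≠ ⊤) :
    ∃ A ⊆ F, IsCompact A ∧ m A ≠ 0 ∧ m A ≠ ⊤ ∧
      ∀ S, MeasurableSet S → Disjoint S E → m (S ∩ A) = 0 := by
  set B := toMeasurable m E ∩ F with hB
  have hBm : MeasurableSet B := (measurableSet_toMeasurable m E).inter hF.measurableSet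
  have hEB : E ⊆ B := Set.subset_inter (subset_toMeasurable m E) hEF
  have hBE : m B = m E := le_antisymm
    ((measure_mono Set.inter_subset_left).trans (measure_toMeasurable E).le) (measure_mono hEB)
  have hfin : IsFiniteMeasure (m.restrict B) :=
    ⟨by rw [Measure.restrict_apply_univ, hBE]; exact lt_top_iff_ne_top.2 hEt⟩
  obtain ⟨A, hAB, hA, hmA⟩ := hBm.exists_lt_isCompact_of_ne_top (μ := m.restrict B)
    (measure_ne_top _ _) (r := 0)
    (by rw [Measure.restrict_apply_self, hBE]; exact pos_iff_ne_zero.2 hE0)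
  rw [Measure.restrict_apply hA.measurableSet, Set.inter_eq_left.2 hAB] at hmA
  refine ⟨A, hAB.trans Set.inter_subset_right, hA, hmA.ne',
    ne_top_of_le_ne_top (hBE ▸ hEt) (measure_mono hAB), fun S hS hSE => ?_⟩
  refine measure_mono_null (Set.inter_subset_inter_right S hAB) ?_
  have h1 : m B ≤ m (B \ S) := by
    rw [hBE]
    exact measure_mono fun y hy => ⟨hEB hy, fun hyS => Set.disjoint_left.1 hSE hyS hy⟩
  have h2 := measure_inter_add_sdiff (μ := m) B hS
  have h3 : m (B \ S) ≠ ⊤ := ne_top_of_le_ne_top (hBE ▸ hEt) (measure_mono Set.sdiff_subset)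
  rw [Set.inter_comm]
  have h4 : m (B ∩ S) + m (B \ S) ≤ 0 + m (B \ S) := by rw [h2, zero_add]; exact h1
  exact le_antisymm ((ENNReal.add_le_add_iff_right h3).1 h4) zero_le

theorem exists_gauge_sublevel_measure_ne_zero [MetricSpace X] [MeasurableSpace X]
    (m : Measure X) (g : X → ℝ≥0∞) (x : X) (h : 0 < m {z | z ≠ x ∧ g z < ⊤}) :
    ∃ r R : ℝ, 0 < r ∧
      m {z | (r ≤ dist z x ∧ dist z x ≤ R) ∧ g z ≤ ENNReal.ofReal R} ≠ 0 := by
  by_contra! hcon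
  refine h.ne' (measure_mono_null (t := ⋃ n : ℕ, {z | (1 / ((n : ℝ) + 1) ≤ dist z x ∧
    dist z x ≤ n) ∧ g z ≤ ENNReal.ofReal n}) ?_
    (measure_iUnion_null fun n => hcon _ _ (by positivity)))
  rintro z ⟨hzx, hg⟩
  obtain ⟨a, ha⟩ := exists_nat_one_div_lt (dist_pos.2 hzx)
  obtain ⟨b, hb⟩ := exists_nat_ge (max (dist z x) (g z).toReal)
  refine Set.mem_iUnion.2 ⟨max a b, ⟨?_, ?_⟩, ?_⟩
  · refine le_trans ?_ ha.le
    gcongr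
    exact le_max_left a b
  · exact (le_max_left _ _).trans (hb.trans (by exact_mod_cast le_max_right a b))
  · rw [← ENNReal.ofReal_toReal hg.ne]
    refine ENNReal.ofReal_le_ofReal ?_
    exact (le_max_right _ _).trans (hb.trans (by exact_mod_cast le_max_right a b))

theorem normalized_restrict_mem_PbsStar [MetricSpace X] [MeasurableSpace X] [BorelSpace X]
    (m : Measure X) [SigmaFinite m] {A : Set X} (hA : IsCompact A) (h0 : m A ≠ 0)
    (ht : m A ≠ ⊤) : (m A)⁻¹ • m.restrict A ∈ PbsStar m ∧ mSupp ((m A)⁻¹ • m.restrict A) ⊆ A := by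
  have hsub : mSupp ((m A)⁻¹ • m.restrict A) ⊆ A :=
    mSupp_subset_of_measure_compl_eq_zero hA.isClosed (by
      rw [Measure.smul_apply, Measure.restrict_apply hA.measurableSet.compl]; simp)
  refine ⟨⟨⟨⟨?_⟩, hA.isBounded.subset hsub, ?_⟩, ?_⟩, hsub⟩
  · simp [ENNReal.inv_mul_cancel h0 ht]
  · exact mSupp_mono_of_absolutelyContinuous
      (Measure.smul_absolutelyContinuous.trans Measure.absolutelyContinuous_restrict)
  · rw [Ent_normalized_restrict m hA.measurableSet h0 ht]
    exact EReal.coe_ne_top _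

theorem W2sq_dirac_ne_top [MetricSpace X] [MeasurableSpace X] [BorelSpace X]
    [SecondCountableTopology X] (x : X) (μ : Measure X) [IsProbabilityMeasure μ] {A : Set X}
    (hA : Bornology.IsBounded A) (hμ : μ Aᶜ = 0) : W2sq (Measure.dirac x) μ ≠ ⊤ := by
  obtain ⟨R, hR⟩ := hA.subset_closedBall x
  have h := W2sq_le_lintegral_of_map μ (fun _ : X => x) id measurable_const measurable_id
  rw [Measure.map_const, measure_univ, one_smul, Measure.map_id] at h
  refine ne_top_of_le_ne_top ?_ (h.trans (lintegral_mono_ae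
    (g := fun _ => ENNReal.ofReal R ^ 2) ?_))
  · simp
  · have hae : ∀ᵐ y ∂μ, y ∈ A := by rw [ae_iff]; exact hμ
    filter_upwards [hae] with y hy
    gcongr
    rw [edist_comm, id, edist_dist]
    exact ENNReal.ofReal_le_ofReal (hR hy)

/-- Polynomial lower bound for the measure of intermediate points along dyadic times. -/
theorem MCP.exists_measure_Zt_lower_bound [MetricSpace X] [MeasurableSpace X] [BorelSpace X]
    [CompleteSpace X] [SecondCountableTopology X] {m : Measure X} (hm : FiniteOnBounded m)
    {G : X → X → ℝ≥0∞} {s : ℝ → ℝ} {N : ℝ} (hsN : DistortionData s N)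
    (hMCP : MCP m G (beta s N)) {x : X} (hx : x ∈ mSupp m)
    (hnontriv : 0 < m {z | z ≠ x ∧ G x z < ⊤}) :
    ∃ (A : Set X) (K : ℝ), IsCompact A ∧ x ∉ A ∧ 0 < m A ∧ 0 < K ∧
      ∀ᶠ k : ℕ in atTop,
        ENNReal.ofReal (K * (1 / 2 ^ k : ℝ) ^ N) * m A ≤ m (Zt (1 / 2 ^ k) {x} A) := by
  have := hm.isLocallyFiniteMeasure
  obtain ⟨r, R, hr, hE0⟩ := exists_gauge_sublevel_measure_ne_zero m (G x) x hnontriv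
  set F : Set X := {z | r ≤ dist z x ∧ dist z x ≤ R} with hF
  set E : Set X := {z | (r ≤ dist z x ∧ dist z x ≤ R) ∧ G x z ≤ ENNReal.ofReal R} with hE
  have hc : Continuous fun z : X => dist z x := by fun_prop
  have hFcl : IsClosed F := (isClosed_le continuous_const hc).inter (isClosed_le hc continuous_const)
  have hEF : E ⊆ F := fun z hz => hz.1
  have hFb : Bornology.IsBounded F := Metric.isBounded_closedBall.subset
    (fun z hz => hz.2 : F ⊆ Metric.closedBall x R)
  have hEt : m E ≠ ⊤ := (hm E (hFb.subset hEF)).ne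
  obtain ⟨A, hAF, hA, hA0, hAt, hfull⟩ := exists_isCompact_full_outer_measure m hFcl hEF hE0 hEt
  have hxA : x ∉ A := fun h => by
    have := (hAF h).1
    rw [dist_self] at this
    linarith
  obtain ⟨K, t₀, hK, hK1, ht₀, hβ⟩ := hsN.exists_beta_lower_bound R
  obtain ⟨hμ1, hsupp⟩ := normalized_restrict_mem_PbsStar m hA hA0 hAt
  set μ1 := (m A)⁻¹ • m.restrict A with hμdef
  have hprob : IsProbabilityMeasure μ1 := hμ1.1.1
  have hμA : μ1 Aᶜ = 0 := by
    rw [hμdef, Measure.smul_apply, Measure.restrict_apply hA.measurableSet.compl]; simp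
  have hfull' : ∀ S, MeasurableSet S → Disjoint S E → μ1 S = 0 := by
    intro S hS hSE
    rw [hμdef, Measure.smul_apply, Measure.restrict_apply hS, hfull S hS hSE, smul_zero]
  obtain ⟨μ, hμ, hμ0, hμ1', hU⟩ := hMCP x hx μ1 hμ1 fun h => hxA (hsupp h)
  have hW : W2sq (μ 0) (μ 1) ≠ ⊤ := by
    rw [hμ0, hμ1']
    exact W2sq_dirac_ne_top x μ1 hA.isBounded hμA
  refine ⟨A, K, hA, hxA, pos_iff_ne_zero.2 hA0, hK, ?_⟩
  have hlim : Tendsto (fun k : ℕ => (1 / 2 ^ k : ℝ)) atTop (𝓝 0) := by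
    simpa using tendsto_pow_atTop_nhds_zero_of_lt_one (r := (1 / 2 : ℝ)) (by norm_num) (by norm_num)
  filter_upwards [hlim.eventually_lt_const ht₀, eventually_ge_atTop 1] with k hk hk1
  have hk0 : (0 : ℝ) < 1 / 2 ^ k := by positivity
  have hklt : (1 / 2 ^ k : ℝ) < 1 := by
    rw [div_lt_one (by positivity)]
    exact one_lt_pow₀ _root_.one_lt_two (Nat.one_le_iff_ne_zero.1 hk1)
  obtain ⟨T, hTm, hTZ, hT⟩ := hμ.exists_measurableSet_subset_Zt hW (isCompact_singleton (x := x))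
    hA (by rw [hμ0]; simp) (by rw [hμ1']; exact hμA) k
  have hprobk := hμ.prob (1 / 2 ^ k) ⟨hk0.le, hklt.le⟩
  have hN : 0 ≤ N := zero_le_one.trans hsN.one_le
  have hexp := le_exp_eintegral_log μ1 (fun y => beta s N (1 / 2 ^ k) (G x y)) E
    (c := K * (1 / 2 ^ k : ℝ) ^ N) (by positivity)
    (mul_le_one₀ hK1 (by positivity) (Real.rpow_le_one hk0.le hklt.le hN)) hfull'
    (fun y hy => hβ _ hk0 hk _ hy.2)
  calc ENNReal.ofReal (K * (1 / 2 ^ k : ℝ) ^ N) * m A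
      = ENNReal.ofReal (K * (1 / 2 ^ k : ℝ) ^ N) * UnE 1 μ1 m := by
        rw [hμdef, UnE_one_normalized_restrict m hA.measurableSet hA0 hAt]
    _ ≤ _ := by gcongr
    _ ≤ UnE 1 (μ (1 / 2 ^ k)) m := hU _ ⟨hk0, hklt⟩ 1 le_rfl
    _ ≤ m T := UnE_one_le_of_measure_compl_eq_zero _ m hTm hT
    _ ≤ _ := measure_mono hTZ

theorem MCP.Csig_eq_top [MetricSpace X] [MeasurableSpace X] [BorelSpace X]
    [CompleteSpace X] [SecondCountableTopology X] {m : Measure X} (hm : FiniteOnBounded m)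
    {G : X → X → ℝ≥0∞} {s : ℝ → ℝ} {N : ℝ} (hsN : DistortionData s N)
    (hMCP : MCP m G (beta s N)) {x : X} (hx : x ∈ mSupp m)
    (hnontriv : 0 < m {z | z ≠ x ∧ G x z < ⊤}) {σ : ℝ} (hσ : N < σ) : Csig m σ x = ⊤ := by
  obtain ⟨A, K, hA, hxA, hA0, hK, hZ⟩ := hMCP.exists_measure_Zt_lower_bound hm hsN hx hnontriv
  have hAt : m A < ⊤ := hm A hA.isBounded
  refine ENNReal.eq_top_of_forall_nnreal_le fun b => ?_
  refine le_iSup_of_le A <| le_iSup_of_le hA.measurableSet <| le_iSup_of_le hA.isBounded <|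
    le_iSup_of_le hxA <| le_iSup_of_le hA0 <| le_iSup_of_le hAt ?_
  refine le_limsup_of_frequently_le ?_ (by isBoundedDefault)
  have hlim0 : Tendsto (fun k : ℕ => (1 / 2 ^ k : ℝ)) atTop (𝓝 0) := by
    simpa using tendsto_pow_atTop_nhds_zero_of_lt_one (r := (1 / 2 : ℝ)) (by norm_num) (by norm_num)
  have hlim : Tendsto (fun k : ℕ => (1 / 2 ^ k : ℝ)) atTop (𝓝[>] 0) :=
    tendsto_nhdsWithin_iff.2 ⟨hlim0, Eventually.of_forall fun k => by
      change (0 : ℝ) < 1 / 2 ^ k; positivity⟩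
  refine hlim.frequently (Eventually.frequently ?_)
  have hbig : Tendsto (fun k : ℕ => K * (1 / 2 ^ k : ℝ) ^ (-(σ - N))) atTop atTop :=
    ((tendsto_rpow_neg_nhdsGT_zero (by linarith)).comp hlim).const_mul_atTop hK
  filter_upwards [hZ, hbig.eventually_ge_atTop (b : ℝ)] with k hk hkb
  have hk0 : (0 : ℝ) < 1 / 2 ^ k := by positivity
  rw [ENNReal.le_div_iff_mul_le (Or.inl hA0.ne') (Or.inl hAt.ne)]
  calc (b : ℝ≥0∞) * m A
      ≤ ENNReal.ofReal (K * (1 / 2 ^ k : ℝ) ^ (-(σ - N))) * m A := by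
        gcongr
        rw [← ENNReal.ofReal_coe_nnreal]
        exact ENNReal.ofReal_le_ofReal hkb
    _ = ENNReal.ofReal ((1 / 2 ^ k : ℝ) ^ (-σ))
          * (ENNReal.ofReal (K * (1 / 2 ^ k : ℝ) ^ N) * m A) := by
        rw [← mul_assoc, ← ENNReal.ofReal_mul (by positivity), mul_left_comm,
          ← Real.rpow_add hk0]
        congr 4
        ring
    _ ≤ _ := by gcongr

theorem dimGeo_le_of_forall_Csig_eq_top [MetricSpace X] [MeasurableSpace X] {m : Measure X}
    {x : X} {N : ℝ} (hN : 0 ≤ N) (h : ∀ σ, N < σ → Csig m σ x = ⊤) :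
    dimGeo m x ≤ ENNReal.ofReal N := by
  have hlim : Tendsto (fun n : ℕ => ENNReal.ofReal (N + 1 / ((n : ℝ) + 1))) atTop
      (𝓝 (ENNReal.ofReal (N + 0))) :=
    ENNReal.tendsto_ofReal (tendsto_const_nhds.add tendsto_one_div_add_atTop_nhds_zero_nat)
  rw [add_zero] at hlim
  refine ge_of_tendsto' hlim fun n => ?_
  have hn : (0 : ℝ) < 1 / ((n : ℝ) + 1) := by positivity
  exact sInf_le ⟨_, ⟨by positivity, h _ (by linarith)⟩, rfl⟩

theorem Zt_singleton_subset_closedBall [MetricSpace X] {x : X} {A : Set X} {R t : ℝ}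
    (hA : A ⊆ Metric.closedBall x R) (ht : t ∈ Set.Icc (0 : ℝ) 1) :
    Zt t {x} A ⊆ Metric.closedBall x (t * R) := by
  rintro y ⟨γ, h0, h1, rfl⟩
  have hd := γ.2 0 ⟨t, ht⟩
  have e0 : γ.1 0 = x := by
    have : geval γ 0 = x := h0
    rwa [geval, Set.projIcc_left] at this
  have e1 : dist (γ.1 1) x ≤ R := by
    have : dist (geval γ 1) x ≤ R := hA h1
    rwa [geval, Set.projIcc_right] at this
  have et : geval γ t = γ.1 ⟨t, ht⟩ := by rw [geval, Set.projIcc_of_mem zero_le_one ht]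
  rw [Metric.mem_closedBall, et, dist_comm, ← e0]
  rw [← e0, dist_comm] at e1
  refine hd.le.trans ?_
  have habs : |((0 : unitInterval) : ℝ) - t| = t := by simp [abs_of_nonneg ht.1]
  change |((0 : unitInterval) : ℝ) - t| * _ ≤ _
  rw [habs]
  exact mul_le_mul_of_nonneg_left e1 ht.1

/-- Below the geodesic dimension threshold, small balls have at least polynomial measure along a
sequence of radii. -/
theorem exists_closedBall_measure_ge [MetricSpace X] [MeasurableSpace X] {m : Measure X} {x : X}
    {σ : ℝ} (h : dimGeo m x < ENNReal.ofReal σ) {ε : ℝ} (hε : 0 < ε) :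
    ∃ r, 0 < r ∧ r ≤ ε ∧ ENNReal.ofReal (r ^ σ) ≤ m (Metric.closedBall x r) := by
  obtain ⟨_, ⟨τ, ⟨hτ, hC⟩, rfl⟩, hτσ⟩ := sInf_lt_iff.1 h
  have hτσ' : τ < σ := (ENNReal.ofReal_lt_ofReal_iff_of_nonneg hτ.le).1 hτσ
  have hC0 : 0 < Csig m τ x := by rw [hC]; exact ENNReal.zero_lt_top
  simp only [Csig, lt_iSup_iff] at hC0
  obtain ⟨A, -, hAb, -, hA0, hAt, hlim⟩ := hC0
  obtain ⟨R, hR0, hAR⟩ := hAb.subset_closedBall_lt 0 x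
  obtain ⟨c, hc0, hc⟩ := exists_between hlim
  have hct : c ≠ ⊤ := ne_top_of_lt hc
  have hfreq := Filter.frequently_lt_of_lt_limsup (by isBoundedDefault) hc
  set C := (c * m A).toReal with hCdef
  have hcA : c * m A ≠ ⊤ := ENNReal.mul_ne_top hct hAt.ne
  have hCpos : 0 < C := ENNReal.toReal_pos (mul_ne_zero hc0.ne' hA0.ne') hcA
  have hpow : Tendsto (fun t : ℝ => R ^ σ * t ^ (σ - τ)) (𝓝[>] 0) (𝓝 (R ^ σ * 0)) := by
    refine Tendsto.const_mul _ (tendsto_nhdsWithin_of_tendsto_nhds ?_)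
    have := (Real.continuousAt_rpow_const 0 (σ - τ) (Or.inr (by linarith))).tendsto
    rwa [Real.zero_rpow (by linarith)] at this
  rw [mul_zero] at hpow
  have hid : Tendsto (fun t : ℝ => t * R) (𝓝[>] 0) (𝓝 (0 * R)) :=
    (tendsto_nhdsWithin_of_tendsto_nhds tendsto_id).mul_const R
  rw [zero_mul] at hid
  obtain ⟨t, htc, htC, htε, ht0, ht1⟩ := (hfreq.and_eventually
    ((hpow.eventually_lt_const hCpos).and ((hid.eventually_lt_const hε).and
      (Ioo_mem_nhdsGT (_root_.zero_lt_one (α := ℝ)))))).exists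
  refine ⟨t * R, by positivity, htε.le, ?_⟩
  rw [ENNReal.lt_div_iff_mul_lt (Or.inl hA0.ne') (Or.inl hAt.ne)] at htc
  calc ENNReal.ofReal ((t * R) ^ σ)
      = ENNReal.ofReal (t ^ τ) * ENNReal.ofReal (R ^ σ * t ^ (σ - τ)) := by
        rw [← ENNReal.ofReal_mul (by positivity), Real.mul_rpow ht0.le hR0.le, mul_left_comm,
          ← Real.rpow_add ht0, mul_comm]
        congr 3
        ring
    _ ≤ ENNReal.ofReal (t ^ τ) * (c * m A) := by
        gcongr
        rw [← ENNReal.ofReal_toReal hcA]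
        exact ENNReal.ofReal_le_ofReal htC.le
    _ ≤ ENNReal.ofReal (t ^ τ) * (ENNReal.ofReal (t ^ (-τ)) * m (Zt t {x} A)) := by gcongr
    _ = m (Zt t {x} A) := by
        rw [← mul_assoc, ← ENNReal.ofReal_mul (by positivity), ← Real.rpow_add ht0,
          add_neg_cancel, Real.rpow_zero, ENNReal.ofReal_one, one_mul]
    _ ≤ _ := measure_mono (Zt_singleton_subset_closedBall hAR ⟨ht0.le, ht1.le⟩)

theorem exists_countable_cover_tsum_ediam_le [MetricSpace X] [MeasurableSpace X] [BorelSpace X]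
    [TopologicalSpace.SeparableSpace X] {m : Measure X} {S : Set X} {x₀ : X} {ρ σ ε : ℝ}
    (hσ : 0 ≤ σ) (hSρ : S ⊆ Metric.closedBall x₀ ρ)
    (h : ∀ x ∈ S, ∃ r, 0 < r ∧ r ≤ ε ∧ ENNReal.ofReal (r ^ σ) ≤ m (Metric.closedBall x r)) :
    ∃ (u : Set X) (B : X → Set X), u.Countable ∧ (∀ x ∈ u, Metric.ediam (B x) ≤
        ENNReal.ofReal (10 * ε)) ∧ S ⊆ ⋃ x : u, B x ∧
      ∑' x : u, Metric.ediam (B x) ^ σ ≤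
        ENNReal.ofReal (10 ^ σ) * m (Metric.closedBall x₀ (ρ + ε)) := by
  choose! r hr0 hrε hrm using h
  obtain ⟨u, huS, hdisj, hcov⟩ := Vitali.exists_disjoint_subfamily_covering_enlargement_closedBall
    S id r ε hrε 5 (by norm_num)
  simp only [id] at hdisj hcov
  have hu : u.Countable := hdisj.countable_of_nonempty_interior fun x hx =>
    ⟨x, Metric.ball_subset_interior_closedBall (Metric.mem_ball_self (hr0 x (huS hx)))⟩
  have hdiam : ∀ x ∈ u, Metric.ediam (Metric.closedBall x (5 * r x)) ≤
      ENNReal.ofReal (10 * r x) := fun x _ =>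
    Metric.ediam_le_of_forall_dist_le fun y hy z hz => by
      have := dist_triangle_right y z x
      rw [Metric.mem_closedBall] at hy hz
      linarith
  refine ⟨u, fun x => Metric.closedBall x (5 * r x), hu, fun x hx => (hdiam x hx).trans ?_,
    fun x hx => ?_, ?_⟩
  · exact ENNReal.ofReal_le_ofReal (by linarith [hrε x (huS hx)])
  · obtain ⟨y, hy, hxy⟩ := hcov x hx
    exact Set.mem_iUnion.2 ⟨⟨y, hy⟩, hxy (Metric.mem_closedBall_self (hr0 x hx).le)⟩
  · calc ∑' x : u, Metric.ediam (Metric.closedBall (x : X) (5 * r x)) ^ σ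
        ≤ ∑' x : u, ENNReal.ofReal (10 ^ σ) * m (Metric.closedBall (x : X) (r x)) := by
          refine ENNReal.tsum_le_tsum fun x => ?_
          have hx := hr0 x (huS x.2)
          calc _ ≤ ENNReal.ofReal (10 * r x) ^ σ := by
                gcongr
                exact hdiam x x.2
            _ = ENNReal.ofReal (10 ^ σ) * ENNReal.ofReal (r x ^ σ) := by
                rw [ENNReal.ofReal_rpow_of_nonneg (by positivity) hσ,
                  Real.mul_rpow (by norm_num) hx.le, ENNReal.ofReal_mul (by positivity)]
            _ ≤ _ := by gcongr; exact hrm x (huS x.2)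
      _ = ENNReal.ofReal (10 ^ σ) * m (⋃ x ∈ u, Metric.closedBall x (r x)) := by
          rw [ENNReal.tsum_mul_left, measure_biUnion hu hdisj
            fun x _ => isClosed_closedBall.measurableSet]
      _ ≤ _ := by
          gcongr
          refine Set.iUnion₂_subset fun x hx => Metric.closedBall_subset_closedBall' ?_
          have h1 := hrε x (huS hx)
          have h2 : dist x x₀ ≤ ρ := hSρ (huS hx)
          linarith

theorem hausdorffMeasure_ne_top_of_closedBall_measure_ge [MetricSpace X] [MeasurableSpace X]
    [BorelSpace X] [TopologicalSpace.SeparableSpace X] {m : Measure X} (hm : FiniteOnBounded m)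
    {S : Set X} (hS : Bornology.IsBounded S) {σ : ℝ} (hσ : 0 ≤ σ)
    (h : ∀ x ∈ S, ∀ ε > 0, ∃ r, 0 < r ∧ r ≤ ε ∧
      ENNReal.ofReal (r ^ σ) ≤ m (Metric.closedBall x r)) : μH[σ] S ≠ ⊤ := by
  rcases S.eq_empty_or_nonempty with rfl | ⟨x₀, -⟩
  · simp
  obtain ⟨ρ, hρ⟩ := hS.subset_closedBall x₀
  have hε : ∀ n : ℕ, (0 : ℝ) < 1 / ((n : ℝ) + 1) := fun n => by positivity
  choose u B hu hB hcov hsum using fun n : ℕ => exists_countable_cover_tsum_ediam_le hσ hρ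
    fun x hx => h x hx _ (hε n)
  have hcount : ∀ n, Countable (u n) := fun n => (hu n).to_subtype
  have hlim : Tendsto (fun n : ℕ => ENNReal.ofReal (10 * (1 / ((n : ℝ) + 1)))) atTop (𝓝 0) := by
    have := ENNReal.tendsto_ofReal (tendsto_one_div_add_atTop_nhds_zero_nat (𝕜 := ℝ).const_mul 10)
    rwa [mul_zero, ENNReal.ofReal_zero] at this
  have hle := Measure.hausdorffMeasure_le_liminf_tsum σ S _ hlim (fun n (x : u n) => B n x)
    (Eventually.of_forall fun n x => hB n x x.2) (Eventually.of_forall hcov)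
  have hfin : ENNReal.ofReal (10 ^ σ) * m (Metric.closedBall x₀ (ρ + 1)) ≠ ⊤ :=
    ENNReal.mul_ne_top ENNReal.ofReal_ne_top (hm _ Metric.isBounded_closedBall).ne
  refine ne_top_of_le_ne_top hfin (hle.trans ?_)
  refine (liminf_le_liminf (v := fun _ : ℕ =>
    ENNReal.ofReal (10 ^ σ) * m (Metric.closedBall x₀ (ρ + 1)))
    (Eventually.of_forall fun n => (hsum n).trans ?_)).trans (by simp)
  gcongr
  rw [div_le_one (by positivity)]
  linarith [n.cast_nonneg (α := ℝ)]

theorem dimH_mSupp_le_dimGeoS [MetricSpace X] [MeasurableSpace X] [BorelSpace X]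
    [TopologicalSpace.SeparableSpace X] {m : Measure X} (hm : FiniteOnBounded m) :
    dimH (mSupp m) ≤ dimGeoS m (mSupp m) := by
  rcases (mSupp m).eq_empty_or_nonempty with hempty | ⟨x₀, -⟩
  · simp [hempty]
  have hcover : mSupp m ⊆ ⋃ n : ℕ, mSupp m ∩ Metric.ball x₀ n := by
    rw [← Set.inter_iUnion, Metric.iUnion_ball_nat, Set.inter_univ]
  refine (dimH_mono hcover).trans ?_
  rw [dimH_iUnion]
  refine iSup_le fun n => dimH_le fun σ htop => ?_
  by_contra! hlt
  refine hausdorffMeasure_ne_top_of_closedBall_measure_ge hm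
    (Metric.isBounded_ball.subset Set.inter_subset_right) σ.2 (fun x hx ε hε => ?_) htop
  refine exists_closedBall_measure_ge ?_ hε
  have hx' : dimGeo m x ≤ dimGeoS m (mSupp m) := le_iSup₂_of_le x hx.1 le_rfl
  exact (hx'.trans_lt hlt).trans_eq (ENNReal.ofReal_coe_nnreal).symm

/-- Geodesic dimension estimate for `MCP(β)` gauge metric measure
spaces. -/
theorem geodesic_dimension_estimate {X : Type*} [MetricSpace X] [MeasurableSpace X]
    [BorelSpace X] [CompleteSpace X] [TopologicalSpace.SeparableSpace X]
    (m : Measure X) (hm : FiniteOnBounded m) (G : X → X → ℝ≥0∞)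
    (s : ℝ → ℝ) (N : ℝ) (hsN : DistortionData s N)
    (hMCP : MCP m G (beta s N))
    (hnontriv : ∀ x ∈ mSupp m, 0 < m {z | z ≠ x ∧ G x z < ⊤}) :
    (∀ x ∈ mSupp m, dimGeo m x ≤ ENNReal.ofReal N) ∧
      dimH (mSupp m) ≤ dimGeoS m (mSupp m) ∧ dimGeoS m (mSupp m) ≤ ENNReal.ofReal N := by
  have := UniformSpace.secondCountable_of_separable X
  have hle : ∀ x ∈ mSupp m, dimGeo m x ≤ ENNReal.ofReal N := fun x hx =>
    dimGeo_le_of_forall_Csig_eq_top (zero_le_one.trans hsN.one_le) fun σ hσ =>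
      hMCP.Csig_eq_top hm hsN hx (hnontriv x hx) hσ
  exact ⟨hle, dimH_mSupp_le_dimGeoS hm, iSup₂_le hle⟩

end GMMS
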